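/- Let K be a convex body in R^n with nonempty interior and centre of mass at the origin, let λ_min(K) > 0 be the smallest eigenvalue of the coefficient matrix of the rank-2 surface tensor Φ_{n-1}^2(K), and let S(K) be the surface area of K. Set R = (S(K)/(4π λ_min(K))) (S(K)/ω_n)^{1/(n−1)}. Then K ⊆ R B^n. -/

import Mathlib

open MeasureTheory Metric Real Filter
open scoped InnerProductSpace ENNReal NNReal Topology

noncomputable section

abbrev En (n : ℕ) := EuclideanSpace ℝ (Fin n)

abbrev Sph (n : ℕ) : Set (En n) := Metric.sphere 0 1

/-- The spherical Lebesgue (surface) measure on `S^{n-1}` and the surface area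
`ω_n` of the unit sphere. -/
def sphLebesgue (n : ℕ) : Measure (Sph n) := μH[((n : ℝ) - 1)]

def omegaN (n : ℕ) : ℝ := (sphLebesgue n Set.univ).toReal

/-- `μ` is the surface area measure `S_{n-1}(K, ·)` of the convex body `K`. -/
def IsSurfaceAreaMeasure {n : ℕ} (K : Set (En n)) (μ : Measure (Sph n)) : Prop :=
  ((interior K).Nonempty ∧ ∀ ω : Set (Sph n), MeasurableSet ω →
      μ ω = μH[((n : ℝ) - 1)]
        {x ∈ frontier K | ∃ u ∈ ω, ∀ y ∈ K, ⟪y - x, (u : En n)⟫_ℝ ≤ 0})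
  ∨ (interior K = ∅ ∧ ∃ u u' : Sph n, (u' : En n) = -(u : En n) ∧
      (∃ c : ℝ, ∀ x ∈ K, ⟪x, (u : En n)⟫_ℝ = c) ∧
      μ = (μH[((n : ℝ) - 1)] K) • (Measure.dirac u + Measure.dirac u'))

/-- The coefficient matrix of the rank-2 surface tensor `Φ_{n-1}²(K)`, namely
`(1/(2! ω_3)) ∫ u_i u_j dS_{n-1}(K, du) = (1/(8π)) M(S_{n-1}(K,·))`. -/
def rank2TensorMatrix {n : ℕ} (μ : Measure (Sph n)) : Matrix (Fin n) (Fin n) ℝ :=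
  Matrix.of fun i j => (1 / (8 * π)) * ∫ u, (u : En n) i * (u : En n) j ∂μ

/-- `l` is an eigenvalue of the real matrix `M`. -/
def IsEigenvalue {n : ℕ} (M : Matrix (Fin n) (Fin n) ℝ) (l : ℝ) : Prop :=
  ∃ v : Fin n → ℝ, v ≠ 0 ∧ Matrix.mulVec M v = l • v

/-- One-dimensional Brunn–Minkowski inequality. -/
theorem volume_real_add_le {A B C : Set ℝ} (hA : MeasurableSet A) (hB : MeasurableSet B)
    (hA' : A.Nonempty) (hB' : B.Nonempty) (h : ∀ x ∈ A, ∀ y ∈ B, x + y ∈ C) :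
    volume A + volume B ≤ volume C := by
  have key : ∀ K ⊆ A, IsCompact K → K.Nonempty → ∀ L ⊆ B, IsCompact L → L.Nonempty →
      volume K + volume L ≤ volume C := by
    intro K hKA hK hKne L hLB hL hLne
    obtain ⟨a, haK, ha⟩ := hK.exists_isGreatest hKne
    obtain ⟨b, hbL, hb⟩ := hL.exists_isLeast hLne
    have e1 : volume ((fun x => x + b) '' K) = volume K := by
      rw [Set.image_add_right]; exact measure_preimage_add_right _ _ _
    have e2 : volume ((fun x => a + x) '' L) = volume L := by
      rw [Set.image_add_left]; exact measure_preimage_add _ _ _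
    have hd : AEDisjoint volume ((fun x => x + b) '' K) ((fun x => a + x) '' L) := by
      refine measure_mono_null (t := {a + b}) ?_ (by simp)
      rintro _ ⟨⟨x, hx, rfl⟩, y, hy, hxy⟩
      have h1 := ha hx
      have h2 := hb hy
      simp only [Set.mem_singleton_iff] at *
      linarith
    have hm : NullMeasurableSet ((fun x => a + x) '' L) volume :=
      (hL.image (by fun_prop)).measurableSet.nullMeasurableSet
    rw [← e1, ← e2, ← measure_union₀ hm hd]
    refine measure_mono ?_
    rintro _ (⟨x, hx, rfl⟩ | ⟨y, hy, rfl⟩)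
    · exact h _ (hKA hx) _ (hLB hbL)
    · exact h _ (hKA haK) _ (hLB hy)
  obtain ⟨a, ha⟩ := hA'
  obtain ⟨b, hb⟩ := hB'
  have key' : ∀ K ⊆ A, IsCompact K → ∀ L ⊆ B, IsCompact L → volume K + volume L ≤ volume C := by
    intro K hKA hK L hLB hL
    refine le_trans (add_le_add (measure_mono (Set.subset_insert a K))
      (measure_mono (Set.subset_insert b L))) (key _ ?_ (hK.insert a) ⟨a, by simp⟩ _ ?_
      (hL.insert b) ⟨b, by simp⟩)
    · exact Set.insert_subset ha hKA
    · exact Set.insert_subset hb hLB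
  rw [hA.measure_eq_iSup_isCompact, hB.measure_eq_iSup_isCompact]
  refine ENNReal.biSup_add_biSup_le' (p := fun K => K ⊆ A) (q := fun K => K ⊆ B)
    ⟨∅, by simp⟩ ⟨∅, by simp⟩ ?_
  intro K hK L hL
  by_cases hKc : IsCompact K <;> by_cases hLc : IsCompact L
  · simpa [hKc, hLc] using key' K hK hKc L hL hLc
  · simpa [hKc, hLc] using key' K hK hKc ∅ (by simp) isCompact_empty
  · simpa [hKc, hLc] using key' ∅ (by simp) isCompact_empty L hL hLc
  · simp [hKc, hLc]

theorem volume_real_smul_add_le {A B C : Set ℝ} {p q : ℝ} (hp : 0 < p) (hq : 0 < q)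
    (hA : MeasurableSet A) (hB : MeasurableSet B)
    (hA' : A.Nonempty) (hB' : B.Nonempty) (h : ∀ x ∈ A, ∀ y ∈ B, p * x + q * y ∈ C) :
    ENNReal.ofReal p * volume A + ENNReal.ofReal q * volume B ≤ volume C := by
  have e : ∀ {r : ℝ} (_ : 0 < r) (S : Set ℝ),
      ENNReal.ofReal r * volume S = volume ((fun x => r⁻¹ * x) ⁻¹' S) := by
    intro r hr S
    rw [Real.volume_preimage_mul_left (inv_ne_zero hr.ne'), inv_inv, abs_of_pos hr]
  rw [e hp, e hq]
  refine volume_real_add_le (hA.preimage (by fun_prop)) (hB.preimage (by fun_prop)) ?_ ?_ ?_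
  · obtain ⟨a, ha⟩ := hA'
    exact ⟨p * a, by simpa [hp.ne'] using ha⟩
  · obtain ⟨a, ha⟩ := hB'
    exact ⟨q * a, by simpa [hq.ne'] using ha⟩
  · intro x hx y hy
    have := h _ hx _ hy
    rwa [mul_inv_cancel_left₀ hp.ne', mul_inv_cancel_left₀ hq.ne'] at this

/-- Prékopa–Leindler on the line for functions normalised to have supremum `1`. -/
theorem lintegral_prekopa_normalized {p q : ℝ} (hp : 0 < p) (hq : 0 < q) (hpq : p + q = 1)
    {f g h : ℝ → ℝ} (hf : Measurable f) (hg : Measurable g) (hh : Measurable h)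
    (hf0 : ∀ x, 0 ≤ f x) (hg0 : ∀ x, 0 ≤ g x) (hh0 : ∀ x, 0 ≤ h x)
    (hf1 : ∀ x, f x ≤ 1) (hg1 : ∀ x, g x ≤ 1)
    (hfs : ∀ t < 1, ∃ x, t < f x) (hgs : ∀ t < 1, ∃ x, t < g x)
    (H : ∀ x y, f x ^ p * g y ^ q ≤ h (p * x + q * y)) :
    ENNReal.ofReal p * (∫⁻ x, ENNReal.ofReal (f x)) +
        ENNReal.ofReal q * (∫⁻ x, ENNReal.ofReal (g x))
      ≤ ∫⁻ x, ENNReal.ofReal (h x) := by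
  rw [lintegral_eq_lintegral_meas_lt volume (ae_of_all _ hf0) hf.aemeasurable,
    lintegral_eq_lintegral_meas_lt volume (ae_of_all _ hg0) hg.aemeasurable,
    lintegral_eq_lintegral_meas_lt volume (ae_of_all _ hh0) hh.aemeasurable]
  have anti : ∀ u : ℝ → ℝ, Measurable fun t => volume {a : ℝ | t < u a} := fun u =>
    Antitone.measurable fun s t hst => measure_mono fun a (ha : t < u a) => lt_of_le_of_lt hst ha
  rw [← lintegral_const_mul _ (anti f), ← lintegral_const_mul _ (anti g),
    ← lintegral_add_left ((anti f).const_mul _)]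
  refine setLIntegral_mono (anti h) fun t ht => ?_
  have ht : 0 < t := ht
  by_cases h1 : t < 1
  · refine volume_real_smul_add_le hp hq (measurableSet_lt measurable_const hf)
      (measurableSet_lt measurable_const hg) (hfs t h1) (hgs t h1) fun x hx y hy => ?_
    have hx : t < f x := hx
    have hy : t < g y := hy
    refine lt_of_lt_of_le ?_ (H x y)
    calc t = t ^ p * t ^ q := by rw [← Real.rpow_add ht, hpq, Real.rpow_one]
      _ < f x ^ p * g y ^ q := by gcongr
  · have ef : {a | t < f a} = ∅ := by
      ext a; simpa using (hf1 a).trans (not_lt.1 h1)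
    have eg : {a | t < g a} = ∅ := by
      ext a; simpa using (hg1 a).trans (not_lt.1 h1)
    simp [ef, eg]

theorem ENNReal.rpow_mul_rpow_le_add {p q : ℝ} (hp : 0 < p) (hq : 0 < q) (hpq : p + q = 1)
    (a b : ℝ≥0∞) : a ^ p * b ^ q ≤ ENNReal.ofReal p * a + ENNReal.ofReal q * b := by
  by_cases ha : a = ∞
  · subst ha
    simp [ENNReal.mul_top, hp]
  by_cases hb : b = ∞
  · subst hb
    simp [ENNReal.mul_top, hq]
  lift a to ℝ≥0 using ha
  lift b to ℝ≥0 using hb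
  have := NNReal.geom_mean_le_arith_mean2_weighted ⟨p, hp.le⟩ ⟨q, hq.le⟩ a b
    (NNReal.eq hpq)
  rw [← ENNReal.coe_rpow_of_nonneg _ hp.le, ← ENNReal.coe_rpow_of_nonneg _ hq.le,
    ENNReal.ofReal_eq_coe_nnreal hp.le, ENNReal.ofReal_eq_coe_nnreal hq.le]
  exact_mod_cast this

/-- Prékopa–Leindler on the line for bounded functions. -/
theorem lintegral_prekopa_bounded {p q : ℝ} (hp : 0 < p) (hq : 0 < q) (hpq : p + q = 1)
    {f g h : ℝ → ℝ≥0∞} (hf : Measurable f) (hg : Measurable g) (hh : Measurable h)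
    (hfb : ⨆ x, f x ≠ ∞) (hgb : ⨆ x, g x ≠ ∞)
    (H : ∀ x y, f x ^ p * g y ^ q ≤ h (p * x + q * y)) :
    (∫⁻ x, f x) ^ p * (∫⁻ x, g x) ^ q ≤ ∫⁻ x, h x := by
  set a := ⨆ x, f x with ha
  set b := ⨆ x, g x with hb
  by_cases ha0 : a = 0
  · have : ∀ x, f x = 0 := by simpa [ha] using ha0
    simp [this, hp]
  by_cases hb0 : b = 0
  · have : ∀ x, g x = 0 := by simpa [hb] using hb0
    simp [this, hq]
  have hfa : ∀ x, f x / a ≤ 1 := fun x => ENNReal.div_le_of_le_mul (by simpa using le_iSup f x)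
  have hgb1 : ∀ x, g x / b ≤ 1 := fun x => ENNReal.div_le_of_le_mul (by simpa using le_iSup g x)
  set c := a ^ p * b ^ q with hc
  have hc0 : c ≠ 0 := by simp [hc, ha0, hb0, hfb, hgb]
  have hct : c ≠ ∞ := ENNReal.mul_ne_top (ENNReal.rpow_ne_top_of_nonneg hp.le hfb)
    (ENNReal.rpow_ne_top_of_nonneg hq.le hgb)
  have sup : ∀ {u : ℝ → ℝ≥0∞} {s : ℝ≥0∞}, s = ⨆ x, u x → s ≠ 0 → s ≠ ∞ → (∀ x, u x / s ≤ 1) →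
      ∀ t : ℝ, t < 1 → ∃ x, t < (u x / s).toReal := by
    intro u s hs h0 htop hle t ht
    by_cases ht0 : t < 0
    · exact ⟨0, ht0.trans_le ENNReal.toReal_nonneg⟩
    have : ENNReal.ofReal t * s < ⨆ x, u x := by
      rw [← hs]
      calc ENNReal.ofReal t * s < 1 * s := by
            rw [ENNReal.mul_lt_mul_iff_left h0 htop]
            exact ENNReal.ofReal_lt_one.2 ht
        _ = s := one_mul s
    obtain ⟨x, hx⟩ := lt_iSup_iff.1 this
    refine ⟨x, (ENNReal.ofReal_lt_iff_lt_toReal (not_lt.1 ht0)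
      (ne_top_of_le_ne_top ENNReal.one_ne_top (hle x))).1 ?_⟩
    rwa [ENNReal.lt_div_iff_mul_lt (Or.inl h0) (Or.inl htop)]
  have one : ∀ {y : ℝ≥0∞}, min y 1 ≠ ∞ := fun {y} =>
    ne_top_of_le_ne_top ENNReal.one_ne_top (min_le_right _ _)
  have key := lintegral_prekopa_normalized hp hq hpq
    (f := fun x => (f x / a).toReal) (g := fun x => (g x / b).toReal)
    (h := fun x => (min (h x / c) 1).toReal) (by fun_prop) (by fun_prop) (by fun_prop)
    (fun _ => ENNReal.toReal_nonneg) (fun _ => ENNReal.toReal_nonneg)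
    (fun _ => ENNReal.toReal_nonneg)
    (fun x => by simpa using ENNReal.toReal_mono ENNReal.one_ne_top (hfa x))
    (fun x => by simpa using ENNReal.toReal_mono ENNReal.one_ne_top (hgb1 x))
    (sup ha ha0 hfb hfa) (sup hb hb0 hgb hgb1) (by
      intro x y
      rw [ENNReal.toReal_rpow, ENNReal.toReal_rpow, ← ENNReal.toReal_mul]
      refine ENNReal.toReal_mono one (le_min ?_ ?_)
      · rw [ENNReal.div_rpow_of_nonneg _ _ hp.le, ENNReal.div_rpow_of_nonneg _ _ hq.le]
        rw [ENNReal.le_div_iff_mul_le (Or.inl hc0) (Or.inl hct), hc]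
        refine le_trans (le_of_eq ?_) (H x y)
        rw [mul_mul_mul_comm, ENNReal.div_mul_cancel (by simp [ha0, hfb]) 
          (ENNReal.rpow_ne_top_of_nonneg hp.le hfb), ENNReal.div_mul_cancel (by simp [hb0, hgb]) 
          (ENNReal.rpow_ne_top_of_nonneg hq.le hgb)]
      · exact mul_le_one' (ENNReal.rpow_le_one (hfa x) hp.le) (ENNReal.rpow_le_one (hgb1 y) hq.le))
  simp only [ENNReal.ofReal_toReal one,
    ENNReal.ofReal_toReal (ne_top_of_le_ne_top ENNReal.one_ne_top (hfa _)),
    ENNReal.ofReal_toReal (ne_top_of_le_ne_top ENNReal.one_ne_top (hgb1 _))] at key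
  simp only [div_eq_mul_inv] at key
  rw [lintegral_mul_const _ hf, lintegral_mul_const _ hg] at key
  have key2 := (ENNReal.rpow_mul_rpow_le_add hp hq hpq _ _).trans (key.trans
    (lintegral_mono fun x => min_le_left _ _))
  rw [lintegral_mul_const _ hh, ← div_eq_mul_inv, ← div_eq_mul_inv, ← div_eq_mul_inv,
    ENNReal.le_div_iff_mul_le (Or.inl hc0) (Or.inl hct)] at key2
  refine le_trans (le_of_eq ?_) key2
  rw [ENNReal.div_rpow_of_nonneg _ _ hp.le, ENNReal.div_rpow_of_nonneg _ _ hq.le, hc,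
    mul_mul_mul_comm, ENNReal.div_mul_cancel (by simp [ha0, hfb])
      (ENNReal.rpow_ne_top_of_nonneg hp.le hfb), ENNReal.div_mul_cancel (by simp [hb0, hgb])
      (ENNReal.rpow_ne_top_of_nonneg hq.le hgb)]

/-- Prékopa–Leindler on the line. -/
theorem lintegral_prekopa_real {p q : ℝ} (hp : 0 < p) (hq : 0 < q) (hpq : p + q = 1)
    {f g h : ℝ → ℝ≥0∞} (hf : Measurable f) (hg : Measurable g) (hh : Measurable h)
    (H : ∀ x y, f x ^ p * g y ^ q ≤ h (p * x + q * y)) :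
    (∫⁻ x, f x) ^ p * (∫⁻ x, g x) ^ q ≤ ∫⁻ x, h x := by
  have trunc : ∀ {u : ℝ → ℝ≥0∞}, Measurable u →
      Tendsto (fun k : ℕ => ∫⁻ x, min (u x) k) atTop (𝓝 (∫⁻ x, u x)) := by
    intro u hu
    refine lintegral_tendsto_of_tendsto_of_monotone (fun k => by fun_prop)
      (ae_of_all _ fun x i j hij => min_le_min_left _ (by exact_mod_cast hij))
      (ae_of_all _ fun x => ?_)
    simpa using (tendsto_const_nhds (x := u x)).min ENNReal.tendsto_nat_nhds_top
  have key : ∀ k l : ℕ, (∫⁻ x, min (f x) k) ^ p * (∫⁻ x, min (g x) l) ^ q ≤ ∫⁻ x, h x := by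
    intro k l
    refine lintegral_prekopa_bounded hp hq hpq (by fun_prop) (by fun_prop) hh ?_ ?_ ?_
    · exact ne_top_of_le_ne_top (ENNReal.natCast_ne_top k) (iSup_le fun x => min_le_right _ _)
    · exact ne_top_of_le_ne_top (ENNReal.natCast_ne_top l) (iSup_le fun x => min_le_right _ _)
    · intro x y
      refine le_trans (mul_le_mul' ?_ ?_) (H x y)
      · exact ENNReal.rpow_le_rpow (min_le_left _ _) hp.le
      · exact ENNReal.rpow_le_rpow (min_le_left _ _) hq.le
  by_cases hF0 : ∫⁻ x, f x = 0
  · simp [hF0, hp]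
  by_cases hG0 : ∫⁻ x, g x = 0
  · simp [hG0, hq]
  refine le_of_tendsto (ENNReal.Tendsto.mul ((trunc hf).ennrpow_const p) (Or.inl ?_)
    ((trunc hg).ennrpow_const q) (Or.inl ?_)) (Eventually.of_forall fun k => key k k)
  · simp [hF0, hp.le, hp]
  · simp [hG0, hq.le, hq]

/-- The Prékopa–Leindler inequality. -/
theorem lintegral_prekopa_leindler {p q : ℝ} (hp : 0 < p) (hq : 0 < q) (hpq : p + q = 1) (n : ℕ)
    {f g h : (Fin n → ℝ) → ℝ≥0∞} (hf : Measurable f) (hg : Measurable g) (hh : Measurable h)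
    (H : ∀ x y, f x ^ p * g y ^ q ≤ h (p • x + q • y)) :
    (∫⁻ x, f x) ^ p * (∫⁻ x, g x) ^ q ≤ ∫⁻ x, h x := by
  induction n with
  | zero =>
    simp only [volume_pi, Measure.pi_of_empty (x := (0 : Fin 0 → ℝ)), lintegral_dirac]
    simpa using H 0 0
  | succ n ih =>
    have e : ∀ {u : (Fin (n + 1) → ℝ) → ℝ≥0∞}, Measurable u →
        ∫⁻ x, u x = ∫⁻ s : ℝ, ∫⁻ y : Fin n → ℝ, u (Fin.cons s y) := by
      intro u hu
      have mp := (volume_preserving_piFinSuccAbove (fun _ : Fin (n + 1) => ℝ) 0).symm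
      rw [← mp.lintegral_comp hu, Measure.volume_eq_prod, lintegral_prod]
      · simp [MeasurableEquiv.piFinSuccAbove, Fin.insertNthEquiv]
      · exact (hu.comp mp.measurable).aemeasurable
    have cons_meas :
        Measurable fun z : ℝ × (Fin n → ℝ) => (Fin.cons z.1 z.2 : Fin (n + 1) → ℝ) := by
      refine measurable_pi_lambda _ fun i => ?_
      refine Fin.cases ?_ (fun j => ?_) i
      · simpa using measurable_fst
      · simpa [Function.comp_def] using (measurable_pi_apply j).comp measurable_snd
    have m1 : ∀ {u : (Fin (n + 1) → ℝ) → ℝ≥0∞}, Measurable u →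
        Measurable fun s : ℝ => ∫⁻ y : Fin n → ℝ, u (Fin.cons s y) := fun hu =>
      (hu.comp cons_meas).lintegral_prod_right'
    have m2 : ∀ {u : (Fin (n + 1) → ℝ) → ℝ≥0∞}, Measurable u → ∀ s : ℝ,
        Measurable fun y : Fin n → ℝ => u (Fin.cons s y) := fun hu s =>
      hu.comp (cons_meas.comp measurable_prodMk_left)
    rw [e hf, e hg, e hh]
    refine lintegral_prekopa_real hp hq hpq (m1 hf) (m1 hg) (m1 hh) fun s t => ?_
    refine ih (m2 hf s) (m2 hg t) (m2 hh _) fun x y => ?_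
    refine (H _ _).trans (le_of_eq (congrArg h ?_))
    funext i
    refine Fin.cases ?_ (fun j => ?_) i <;> simp

/-- Brunn–Minkowski for two sets of the same volume. -/
theorem volume_le_of_smul_add_subset {n : ℕ} {p q : ℝ} (hp : 0 < p) (hq : 0 < q) (hpq : p + q = 1)
    {A B C : Set (EuclideanSpace ℝ (Fin n))} (hA : MeasurableSet A) (hB : MeasurableSet B)
    (hC : MeasurableSet C) (h : ∀ x ∈ A, ∀ y ∈ B, p • x + q • y ∈ C)
    (hAB : volume A = volume B) : volume A ≤ volume C := by
  have mp := PiLp.volume_preserving_toLp (Fin n)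
  have key := lintegral_prekopa_leindler hp hq hpq n
    (f := (WithLp.toLp 2 ⁻¹' A).indicator 1) (g := (WithLp.toLp 2 ⁻¹' B).indicator 1)
    (h := (WithLp.toLp 2 ⁻¹' C).indicator 1)
    (measurable_one.indicator (mp.measurable hA)) (measurable_one.indicator (mp.measurable hB))
    (measurable_one.indicator (mp.measurable hC)) (by
      intro x y
      by_cases hx : WithLp.toLp 2 x ∈ A
      · by_cases hy : WithLp.toLp 2 y ∈ B
        · have := h _ hx _ hy
          simp [Set.indicator, hx, hy, this]
        · simp [Set.indicator, hy, hq]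
      · simp [Set.indicator, hx, hp])
  rw [lintegral_indicator_one (mp.measurable hA), lintegral_indicator_one (mp.measurable hB),
    lintegral_indicator_one (mp.measurable hC), mp.measure_preimage hA.nullMeasurableSet,
    mp.measure_preimage hB.nullMeasurableSet, mp.measure_preimage hC.nullMeasurableSet, ← hAB,
    ← ENNReal.rpow_add_of_nonneg _ _ hp.le hq.le, hpq, ENNReal.rpow_one] at key
  exact key

/-- Fubini along the hyperplanes orthogonal to a unit vector. -/
theorem volume_eq_lintegral_slice {m : ℕ} {v : En (m + 1)} (hv : ‖v‖ = 1) {t : Set (En (m + 1))}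
    (ht : MeasurableSet t) :
    volume t = ∫⁻ x : ℝ, μHE[m] (t ∩ {y | ⟪y, v⟫_ℝ = x}) := by
  have hv0 : v ≠ 0 := by rintro rfl; simp at hv
  have h := EuclideanGeometry.euclideanHausdorffMeasure_eq_lintegral (0 : En (m + 1)) hv0 ht
  have hr : Module.finrank ℝ (En (m + 1)) = m + 1 := by simp
  rw [hr, EuclideanSpace.euclideanHausdorffMeasure_eq_volume] at h
  rw [h, ← ofReal_norm, hv, ENNReal.ofReal_one, one_mul]
  refine lintegral_congr fun x => ?_
  have : ((AffineSubspace.mk' (x • v +ᵥ (0 : En (m + 1))) (ℝ ∙ v)ᗮ : AffineSubspace ℝ _) :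
      Set (En (m + 1))) = {y | ⟪y, v⟫_ℝ = x} := by
    ext y
    simp only [SetLike.mem_coe, AffineSubspace.mem_mk',
      Submodule.mem_orthogonal_singleton_iff_inner_left,
      vsub_eq_sub, vadd_eq_add, add_zero, inner_sub_left, inner_smul_left, Set.mem_ofPred_eq,
      real_inner_self_eq_norm_sq, hv]
    simp [sub_eq_zero]
  rw [this]
  rfl

/-- Volume of an oblique prism over a piece of a hyperplane. -/
theorem volume_prism {m : ℕ} {u w : En (m + 1)} (hu : ‖u‖ = 1) (hw : 0 < ⟪w, u⟫_ℝ) {h τ : ℝ}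
    {D : Set (En (m + 1))} (hD : MeasurableSet D) (hDh : ∀ y ∈ D, ⟪y, u⟫_ℝ = h) :
    volume {z | ∃ q ∈ D, ∃ t ∈ Set.Icc 0 τ, z = q + t • w} =
      ENNReal.ofReal (τ * ⟪w, u⟫_ℝ) * μHE[m] D := by
  have e : {z | ∃ q ∈ D, ∃ t ∈ Set.Icc 0 τ, z = q + t • w} =
      {z | (⟪z, u⟫_ℝ - h) / ⟪w, u⟫_ℝ ∈ Set.Icc 0 τ ∧ z - ((⟪z, u⟫_ℝ - h) / ⟪w, u⟫_ℝ) • w ∈ D} := by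
    ext z
    constructor
    · rintro ⟨q, hq, t, ht, rfl⟩
      have : (⟪q + t • w, u⟫_ℝ - h) / ⟪w, u⟫_ℝ = t := by
        rw [inner_add_left, hDh q hq, inner_smul_left]
        field_simp
        simp [mul_comm]
      refine ⟨by rwa [this], ?_⟩
      rwa [this, add_sub_cancel_right]
    · rintro ⟨h1, h2⟩
      exact ⟨_, h2, _, h1, by simp⟩
  have hm : MeasurableSet {z : En (m + 1) | (⟪z, u⟫_ℝ - h) / ⟪w, u⟫_ℝ ∈ Set.Icc 0 τ ∧
      z - ((⟪z, u⟫_ℝ - h) / ⟪w, u⟫_ℝ) • w ∈ D} := by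
    refine MeasurableSet.inter (measurableSet_Icc.preimage ?_) (hD.preimage ?_)
    · fun_prop
    · fun_prop
  rw [e, volume_eq_lintegral_slice hu hm]
  have key : ∀ x : ℝ, μHE[m] ({z : En (m + 1) | (⟪z, u⟫_ℝ - h) / ⟪w, u⟫_ℝ ∈ Set.Icc 0 τ ∧
      z - ((⟪z, u⟫_ℝ - h) / ⟪w, u⟫_ℝ) • w ∈ D} ∩ {y | ⟪y, u⟫_ℝ = x}) =
      (Set.Icc h (h + τ * ⟪w, u⟫_ℝ)).indicator (fun _ => μHE[m] D) x := by
    intro x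
    have hx : (x - h) / ⟪w, u⟫_ℝ ∈ Set.Icc 0 τ ↔ x ∈ Set.Icc h (h + τ * ⟪w, u⟫_ℝ) := by
      simp only [Set.mem_Icc, le_div_iff₀ hw, div_le_iff₀ hw, zero_mul]
      constructor <;> rintro ⟨h1, h2⟩ <;> constructor <;> linarith
    by_cases hx' : x ∈ Set.Icc h (h + τ * ⟪w, u⟫_ℝ)
    · rw [Set.indicator_of_mem hx', ← measure_preimage_add_right (μHE[m])
        (-(((x - h) / ⟪w, u⟫_ℝ) • w)) D]
      congr 1
      ext z
      simp only [Set.mem_inter_iff, Set.mem_ofPred_eq, Set.mem_preimage, ← sub_eq_add_neg]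
      constructor
      · rintro ⟨⟨-, h2⟩, rfl⟩
        exact h2
      · intro hz
        have := hDh _ hz
        rw [inner_sub_left, inner_smul_left] at this
        simp only [conj_trivial, div_mul_cancel₀ _ hw.ne'] at this
        have hzx : ⟪z, u⟫_ℝ = x := by linarith
        rw [hzx]
        exact ⟨⟨hx.2 hx', hz⟩, rfl⟩
    · rw [Set.indicator_of_notMem hx']
      convert measure_empty
      · ext z
        simp only [Set.mem_inter_iff, Set.mem_ofPred_eq, Set.mem_empty_iff_false, iff_false,
          not_and]
        rintro ⟨h1, -⟩ rfl
        exact hx' (hx.1 h1)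
      · infer_instance
  rw [lintegral_congr key, lintegral_indicator_const measurableSet_Icc, Real.volume_Icc, mul_comm,
    add_sub_cancel_left]

theorem cone_eq {m : ℕ} {u : En (m + 1)} {h : ℝ} (hh : 0 < h) {D : Set (En (m + 1))}
    (hDh : ∀ y ∈ D, ⟪y, u⟫_ℝ = h) :
    {z | ∃ t ∈ Set.Ioc (0 : ℝ) 1, ∃ q ∈ D, z = t • q} =
      {z | ⟪z, u⟫_ℝ ∈ Set.Ioc 0 h ∧ (h / ⟪z, u⟫_ℝ) • z ∈ D} := by
  ext z
  constructor
  · rintro ⟨t, ht, q, hq, rfl⟩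
    have : ⟪t • q, u⟫_ℝ = t * h := by
      rw [inner_smul_left, hDh q hq]; rfl
    have ht0 := ht.1
    refine ⟨?_, ?_⟩
    · rw [this]
      exact ⟨by positivity, by nlinarith [ht.2]⟩
    · have : (h / (t * h)) * t = 1 := by field_simp
      rwa [‹⟪t • q, u⟫_ℝ = t * h›, smul_smul, this, one_smul]
  · rintro ⟨h1, h2⟩
    have := h1.1
    refine ⟨⟪z, u⟫_ℝ / h, ⟨by positivity, (div_le_one hh).2 h1.2⟩, _, h2, ?_⟩
    rw [smul_smul, div_mul_div_cancel₀ hh.ne', div_self this.ne', one_smul]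

theorem measurableSet_cone {m : ℕ} {u : En (m + 1)} {h : ℝ} (hh : 0 < h) {D : Set (En (m + 1))}
    (hD : MeasurableSet D) (hDh : ∀ y ∈ D, ⟪y, u⟫_ℝ = h) :
    MeasurableSet {z | ∃ t ∈ Set.Ioc (0 : ℝ) 1, ∃ q ∈ D, z = t • q} := by
  rw [cone_eq hh hDh]
  refine MeasurableSet.inter (measurableSet_Ioc.preimage ?_) (hD.preimage ?_)
  · fun_prop
  · fun_prop

open scoped Pointwise in
/-- Volume of a cone over a piece of a hyperplane. -/
theorem volume_cone {m : ℕ} {u : En (m + 1)} (hu : ‖u‖ = 1) {h : ℝ} (hh : 0 < h)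
    {D : Set (En (m + 1))} (hD : MeasurableSet D) (hDh : ∀ y ∈ D, ⟪y, u⟫_ℝ = h) :
    volume {z | ∃ t ∈ Set.Ioc (0 : ℝ) 1, ∃ q ∈ D, z = t • q} =
      ENNReal.ofReal (h / (m + 1)) * μHE[m] D := by
  have hm := measurableSet_cone hh hD hDh
  rw [cone_eq hh hDh] at hm ⊢
  rw [volume_eq_lintegral_slice hu hm]
  have key : ∀ x : ℝ, μHE[m] ({z : En (m + 1) | ⟪z, u⟫_ℝ ∈ Set.Ioc 0 h ∧
      (h / ⟪z, u⟫_ℝ) • z ∈ D} ∩ {y | ⟪y, u⟫_ℝ = x}) =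
      (Set.Ioc 0 h).indicator (fun x => ENNReal.ofReal ((x / h) ^ m)) x * μHE[m] D := by
    intro x
    by_cases hx : x ∈ Set.Ioc 0 h
    · have hx0 := hx.1
      rw [Set.indicator_of_mem hx]
      have es : {z : En (m + 1) | ⟪z, u⟫_ℝ ∈ Set.Ioc 0 h ∧
          (h / ⟪z, u⟫_ℝ) • z ∈ D} ∩ {y | ⟪y, u⟫_ℝ = x} = (x / h) • D := by
        ext z
        rw [Set.mem_smul_set_iff_inv_smul_mem₀ (by positivity), inv_div]
        constructor
        · rintro ⟨⟨-, h2⟩, rfl⟩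
          exact h2
        · intro hz
          have := hDh _ hz
          rw [inner_smul_left] at this
          simp only [conj_trivial] at this
          have hzx : ⟪z, u⟫_ℝ = x := by field_simp at this; linarith
          refine ⟨⟨?_, ?_⟩, hzx⟩ <;> rw [hzx] <;> assumption
      rw [es, Measure.euclideanHausdorffMeasure_smul₀ m (by positivity : x / h ≠ 0)]
      rw [ENNReal.smul_def, smul_eq_mul]
      congr 1
      rw [ENNReal.ofReal_pow (by positivity), ENNReal.coe_pow]
      congr 1
      rw [← Real.enorm_of_nonneg (by positivity)]
      rfl
    · rw [Set.indicator_of_notMem hx, zero_mul]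
      convert measure_empty
      · ext z
        simp only [Set.mem_inter_iff, Set.mem_ofPred_eq, Set.mem_empty_iff_false, iff_false,
          not_and]
        rintro ⟨h1, -⟩ rfl
        exact hx h1
      · infer_instance
  rw [lintegral_congr key, lintegral_mul_const _ (by
    refine Measurable.indicator ?_ measurableSet_Ioc
    fun_prop), lintegral_indicator measurableSet_Ioc]
  congr 1
  rw [← ofReal_integral_eq_lintegral_ofReal, ← intervalIntegral.integral_of_le hh.le]
  · congr 1
    simp only [div_pow]
    rw [intervalIntegral.integral_div, integral_pow]
    field_simp
    simp [pow_succ]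
  · refine (Continuous.integrableOn_Icc (a := 0) (b := h) ?_).mono_set Set.Ioc_subset_Icc_self
    fun_prop
  · filter_upwards [ae_restrict_mem measurableSet_Ioc] with x hx
    have := hx.1
    positivity

theorem volume_hyperplane {m : ℕ} {c : En (m + 1)} (hc : c ≠ 0) (k : ℝ) :
    volume {y : En (m + 1) | ⟪y, c⟫_ℝ = k} = 0 := by
  have hc' : 0 < ‖c‖ := norm_pos_iff.2 hc
  have hu : ‖(‖c‖⁻¹ • c)‖ = 1 := by simp [norm_smul, hc'.ne']
  have hm : MeasurableSet {y : En (m + 1) | ⟪y, c⟫_ℝ = k} :=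
    (isClosed_eq (by fun_prop) (by fun_prop)).measurableSet
  rw [volume_eq_lintegral_slice hu hm, lintegral_eq_zero_of_ae_eq_zero]
  have : ∀ᵐ x : ℝ, x ≠ k / ‖c‖ := by simp [ae_iff]
  filter_upwards [this] with x hx
  have : {y : En (m + 1) | ⟪y, c⟫_ℝ = k} ∩ {y | ⟪y, ‖c‖⁻¹ • c⟫_ℝ = x} = ∅ := by
    ext z
    simp only [Set.mem_inter_iff, Set.mem_ofPred_eq, Set.mem_empty_iff_false, iff_false, not_and]
    rintro rfl h2
    refine hx ?_
    rw [← h2, inner_smul_right]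
    field_simp
  rw [this, measure_empty]
  rfl

/-- Distinct hyperplanes meet in a set of dimension at most `m - 1`. -/
theorem hausdorff_inter_hyperplanes {m : ℕ} {a b : En (m + 1)} (ha : a ≠ 0) (hab : a ≠ b) :
    μHE[m] {y : En (m + 1) | ⟪y, a⟫_ℝ = 1 ∧ ⟪y, b⟫_ℝ = 1} = 0 := by
  have ha' : 0 < ‖a‖ := norm_pos_iff.2 ha
  set s := ⟪a, b⟫_ℝ / ‖a‖ ^ 2 with hs
  by_cases hc : b - s • a = 0
  · convert measure_empty
    · ext y
      simp only [Set.mem_ofPred_eq, Set.mem_empty_iff_false, iff_false, not_and]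
      intro h1 h2
      have hb : b = s • a := sub_eq_zero.1 hc
      rw [hb, inner_smul_right, h1, mul_one] at h2
      exact hab (by rw [hb, h2, one_smul])
    · infer_instance
  · have hm : MeasurableSet {y : En (m + 1) | ⟪y, a⟫_ℝ = 1 ∧ ⟪y, b⟫_ℝ = 1} :=
      ((isClosed_eq (by fun_prop) (by fun_prop)).inter
        (isClosed_eq (by fun_prop) (by fun_prop))).measurableSet
    have hu : ‖(‖a‖⁻¹ • a)‖ = 1 := by simp [norm_smul, ha'.ne']
    have haa : ⟪a, ‖a‖⁻¹ • a⟫_ℝ = ‖a‖ := by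
      rw [inner_smul_right, real_inner_self_eq_norm_sq]; field_simp
    have h := volume_prism (m := m) (w := a) (τ := 1) hu (by rw [haa]; exact ha') (h := 1 / ‖a‖) hm
      (fun y hy => by rw [inner_smul_right, hy.1]; field_simp)
    have h0 : volume {z | ∃ q ∈ {y : En (m + 1) | ⟪y, a⟫_ℝ = 1 ∧ ⟪y, b⟫_ℝ = 1},
        ∃ t ∈ Set.Icc (0 : ℝ) 1, z = q + t • a} = 0 := by
      refine measure_mono_null ?_ (volume_hyperplane hc (1 - s))
      rintro _ ⟨q, ⟨h1, h2⟩, t, -, rfl⟩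
      simp only [Set.mem_ofPred_eq, inner_add_left, inner_sub_right, inner_smul_left,
        inner_smul_right, h1, h2, real_inner_self_eq_norm_sq, hs, conj_trivial]
      field_simp
      ring
    rw [h0, haa] at h
    rcases mul_eq_zero.1 h.symm with h | h
    · exact absurd h (by simpa using ha')
    · exact h

theorem LipschitzOnWith.euclideanHausdorffMeasure_image_le {X Y : Type*} [EMetricSpace X]
    [EMetricSpace Y] [MeasurableSpace X] [BorelSpace X] [MeasurableSpace Y] [BorelSpace Y]
    {C : ℝ≥0} {f : X → Y} {s : Set X} (hf : LipschitzOnWith C f s) (d : ℕ) :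
    μHE[d] (f '' s) ≤ (C : ℝ≥0∞) ^ d * μHE[d] s := by
  have h := hf.hausdorffMeasure_image_le (d := d) (by positivity)
  rw [ENNReal.rpow_natCast] at h
  simp only [Measure.euclideanHausdorffMeasure_def, Measure.smul_apply, ENNReal.smul_def,
    smul_eq_mul]
  rw [mul_left_comm]
  gcongr

/-- If every point of `t` is related to a point of `s` and the relation contracts distances, then
the Hausdorff measure of `t` is controlled by that of `s`. -/
theorem euclideanHausdorffMeasure_le_of_relation {E F : Type*}
    [NormedAddCommGroup E] [MeasurableSpace E] [BorelSpace E]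
    [NormedAddCommGroup F] [MeasurableSpace F] [BorelSpace F] {s : Set E} {t : Set F} {C : ℝ≥0}
    (d : ℕ) (r : E → F → Prop) (h : ∀ y ∈ t, ∃ x ∈ s, r x y)
    (hr : ∀ x ∈ s, ∀ x' ∈ s, ∀ y ∈ t, ∀ y' ∈ t, r x y → r x' y' → ‖y - y'‖ ≤ C * ‖x - x'‖) :
    μHE[d] t ≤ (C : ℝ≥0∞) ^ d * μHE[d] s := by
  classical
  have : ∀ x : E, ∃ y : F, (∃ y ∈ t, r x y) → (y ∈ t ∧ r x y) := by
    intro x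
    by_cases hx : ∃ y ∈ t, r x y
    · obtain ⟨y, hy⟩ := hx
      exact ⟨y, fun _ => hy⟩
    · exact ⟨0, fun h => absurd h hx⟩
  choose f hf using this
  set s' := {x ∈ s | ∃ y ∈ t, r x y} with hs'
  have hlip : LipschitzOnWith C f s' := by
    refine LipschitzOnWith.of_dist_le_mul fun x hx y hy => ?_
    rw [dist_eq_norm, dist_eq_norm]
    exact hr x hx.1 y hy.1 _ (hf x hx.2).1 _ (hf y hy.2).1 (hf x hx.2).2 (hf y hy.2).2
  have himg : t ⊆ f '' s' := by
    intro y hy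
    obtain ⟨x, hx, hxy⟩ := h y hy
    have hx' : x ∈ s' := ⟨hx, y, hy, hxy⟩
    refine ⟨x, hx', ?_⟩
    have h2 := hf x hx'.2
    have := hr x hx x hx _ h2.1 y hy h2.2 hxy
    simpa [sub_eq_zero] using this
  calc μHE[d] t ≤ μHE[d] (f '' s') := measure_mono himg
    _ ≤ (C : ℝ≥0∞) ^ d * μHE[d] s' := hlip.euclideanHausdorffMeasure_image_le d
    _ ≤ (C : ℝ≥0∞) ^ d * μHE[d] s := by gcongr; exact fun x hx => hx.1

/-- The nearest-point projection onto a set does not increase Hausdorff measure. -/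
theorem euclideanHausdorffMeasure_le_of_nearest {n : ℕ} {s t C : Set (En n)} (d : ℕ) (htC : t ⊆ C)
    (h : ∀ y ∈ t, ∃ x ∈ s, ∀ z ∈ C, ⟪x - y, z - y⟫_ℝ ≤ 0) : μHE[d] t ≤ μHE[d] s := by
  have := euclideanHausdorffMeasure_le_of_relation (s := s) (C := 1) (t := t) d
    (fun x q => ∀ y ∈ C, ⟪x - q, y - q⟫_ℝ ≤ 0) h ?_
  · simpa using this
  · intro x _ x' _ y hy y' hy' h h'
    have h1 := h y' (htC hy')
    have h2 := h' y (htC hy)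
    have h3 : ‖y - y'‖ ^ 2 ≤ ⟪x - x', y - y'⟫_ℝ := by
      rw [← real_inner_self_eq_norm_sq]
      simp only [inner_sub_left, inner_sub_right] at *
      linarith
    have h4 := real_inner_le_norm (x - x') (y - y')
    rw [NNReal.coe_one, one_mul]
    by_contra! h5
    have := norm_nonneg (x - x')
    nlinarith

theorem exists_ray_mem_frontier {n : ℕ} {K : Set (En n)} (hK : IsCompact K) {q a : En n}
    (hq : q ∈ K) (ha : a ≠ 0) : ∃ s : ℝ, 0 ≤ s ∧ q + s • a ∈ frontier K := by
  by_contra! hcon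
  set t := (fun s : ℝ => q + s • a) '' Set.Ici 0 with ht
  have hqi : q ∈ interior K := by
    have h0 := hcon 0 le_rfl
    rw [zero_smul, add_zero, hK.isClosed.frontier_eq] at h0
    by_contra h1
    exact h0 ⟨hq, h1⟩
  have hsub : t ⊆ interior K := by
    refine IsPreconnected.subset_left_of_subset_union isOpen_interior hK.isClosed.isOpen_compl
      (Set.disjoint_left.2 fun x h1 h2 => h2 (interior_subset h1)) ?_
      ⟨q, ⟨0, by simp, by simp⟩, hqi⟩
      (isPreconnected_Ici.image _ (by fun_prop))
    rintro _ ⟨s, hs, rfl⟩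
    by_contra h1
    simp only [Set.mem_union, Set.mem_compl_iff, not_or, not_not] at h1
    have := hcon s hs
    rw [hK.isClosed.frontier_eq] at this
    exact this ⟨h1.2, h1.1⟩
  obtain ⟨R, hR⟩ := hK.isBounded.exists_norm_le
  have hR0 : 0 ≤ R := (norm_nonneg _).trans (hR q hq)
  have ha' : 0 < ‖a‖ := norm_pos_iff.2 ha
  have h1 := hR _ (interior_subset (hsub ⟨(2 * R + 1) / ‖a‖, by simp; positivity, rfl⟩))
  have h2 : ‖((2 * R + 1) / ‖a‖) • a‖ = 2 * R + 1 := by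
    rw [norm_smul, Real.norm_of_nonneg (by positivity)]; field_simp
  have h3 := norm_sub_norm_le (((2 * R + 1) / ‖a‖) • a) (-q)
  rw [norm_neg, sub_neg_eq_add, add_comm _ q, h2] at h3
  have := hR q hq
  linarith

/-- Supporting hyperplane at a boundary point. -/
theorem exists_support {n : ℕ} {K : Set (En n)} (hconv : Convex ℝ K)
    (hint : (interior K).Nonempty) {x : En n} (hx : x ∈ frontier K) :
    ∃ a : En n, (∀ y ∈ K, ⟪y, a⟫_ℝ ≤ ⟪x, a⟫_ℝ) ∧ ∀ y ∈ interior K, ⟪y, a⟫_ℝ < ⟪x, a⟫_ℝ := by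
  obtain ⟨f, hf⟩ := geometric_hahn_banach_open_point hconv.interior isOpen_interior
    (show x ∉ interior K from hx.2)
  set a := (InnerProductSpace.toDual ℝ (En n)).symm f with ha
  have hfa : ∀ y, f y = ⟪y, a⟫_ℝ := fun y => by
    rw [real_inner_comm, ha, InnerProductSpace.toDual_symm_apply]
  simp only [hfa] at hf
  refine ⟨a, fun y hy => ?_, hf⟩
  have h1 : K ⊆ closure (interior K) := by
    rw [hconv.closure_interior_eq_closure_of_nonempty_interior hint]
    exact subset_closure
  have h2 : closure (interior K) ⊆ {y | ⟪y, a⟫_ℝ ≤ ⟪x, a⟫_ℝ} :=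
    closure_minimal (fun y hy => (hf y hy).le) (isClosed_le (by fun_prop) (by fun_prop))
  exact h2 (h1 hy)

theorem measurableSet_polytope {n : ℕ} (A : Finset (En n)) (c : En n → ℝ) :
    MeasurableSet {y : En n | ∀ a ∈ A, ⟪y, a⟫_ℝ ≤ c a} := by
  have : {y : En n | ∀ b ∈ A, ⟪y, b⟫_ℝ ≤ c b} = ⋂ b ∈ A, {y | ⟪y, b⟫_ℝ ≤ c b} := by
    ext; simp
  exact this ▸ Finset.measurableSet_biInter _ fun b _ =>
    (isClosed_le (by fun_prop) (by fun_prop)).measurableSet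

/-- A polytope inside a convex body has facets of smaller total area than the boundary of
the body. -/
theorem facets_le_frontier {m : ℕ} {K : Set (En (m + 1))} (hK : IsCompact K)
    (A : Finset (En (m + 1))) (hA : ∀ a ∈ A, a ≠ 0)
    (hQ : {y | ∀ a ∈ A, ⟪y, a⟫_ℝ ≤ 1} ⊆ K) :
    ∑ a ∈ A, μHE[m] {y | (∀ b ∈ A, ⟪y, b⟫_ℝ ≤ 1) ∧ ⟪y, a⟫_ℝ = 1} ≤ μHE[m] (frontier K) := by
  rw [← measure_biUnion_finset₀]
  · refine euclideanHausdorffMeasure_le_of_nearest m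
      (C := {y : En (m + 1) | ∀ b ∈ A, ⟪y, b⟫_ℝ ≤ 1}) (Set.iUnion₂_subset fun a _ y hy => hy.1) ?_
    intro q hq
    simp only [Set.mem_iUnion, Set.mem_ofPred_eq] at hq
    obtain ⟨a, ha, hq, hqa⟩ := hq
    obtain ⟨s, hs, hsK⟩ := exists_ray_mem_frontier hK (hQ hq) (hA a ha)
    refine ⟨_, hsK, fun y hy => ?_⟩
    rw [add_sub_cancel_left, inner_smul_left, inner_sub_right, real_inner_comm y a,
      real_inner_comm q a, hqa]
    exact mul_nonpos_of_nonneg_of_nonpos hs (by linarith [hy a ha])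
  · intro a ha b hb hab
    refine measure_mono_null ?_ (hausdorff_inter_hyperplanes (hA a ha) hab)
    rintro y ⟨h1, h2⟩
    exact ⟨h1.2, h2.2⟩
  · intro a ha
    exact ((measurableSet_polytope A fun _ => 1).inter
      (isClosed_eq (by fun_prop) (by fun_prop)).measurableSet).nullMeasurableSet

/-- Moving all facets of a polytope inwards by `τ` removes at most `τ` times the surface area. -/
theorem volume_polytope_le {m : ℕ} (A : Finset (En (m + 1))) (hA : ∀ a ∈ A, a ≠ 0) {τ : ℝ} :
    volume {y : En (m + 1) | ∀ a ∈ A, ⟪y, a⟫_ℝ ≤ 1} ≤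
      volume {y : En (m + 1) | ∀ a ∈ A, ⟪y, a⟫_ℝ ≤ 1 - τ * ‖a‖} + ENNReal.ofReal τ *
        ∑ a ∈ A, μHE[m] {y | (∀ b ∈ A, ⟪y, b⟫_ℝ ≤ 1) ∧ ⟪y, a⟫_ℝ = 1} := by
  have prism : ∀ a ∈ A, volume {z | ∃ q ∈ {y : En (m + 1) | (∀ b ∈ A, ⟪y, b⟫_ℝ ≤ 1) ∧ ⟪y, a⟫_ℝ = 1},
      ∃ t ∈ Set.Icc 0 τ, z = q + t • (-(‖a‖⁻¹ • a))} =
      ENNReal.ofReal τ * μHE[m] {y | (∀ b ∈ A, ⟪y, b⟫_ℝ ≤ 1) ∧ ⟪y, a⟫_ℝ = 1} := by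
    intro a ha
    have ha' : 0 < ‖a‖ := norm_pos_iff.2 (hA a ha)
    have hu : ‖-(‖a‖⁻¹ • a)‖ = 1 := by rw [norm_neg]; simp [norm_smul, ha'.ne']
    have hw : ⟪-(‖a‖⁻¹ • a), -(‖a‖⁻¹ • a)⟫_ℝ = 1 := by rw [real_inner_self_eq_norm_sq, hu]; norm_num
    rw [volume_prism hu (by rw [hw]; norm_num) (h := -‖a‖⁻¹), hw, mul_one]
    · exact (measurableSet_polytope A fun _ => 1).inter
        (isClosed_eq (by fun_prop) (by fun_prop)).measurableSet
    · rintro y ⟨-, hy⟩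
      rw [inner_neg_right, inner_smul_right, hy, mul_one]
  rw [Finset.mul_sum, ← Finset.sum_congr rfl prism]
  refine le_trans ?_ (add_le_add_right (measure_biUnion_finset_le A _) _)
  refine le_trans (measure_mono ?_) (measure_union_le _ _)
  intro z hz
  by_cases hz' : ∀ a ∈ A, ⟪z, a⟫_ℝ ≤ 1 - τ * ‖a‖
  · exact Or.inl hz'
  right
  push Not at hz'
  obtain ⟨a₀, ha₀, h₀⟩ := hz'
  obtain ⟨a, ha, hmin⟩ := A.exists_min_image (fun a => (1 - ⟪z, a⟫_ℝ) / ‖a‖) ⟨a₀, ha₀⟩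
  set s := (1 - ⟪z, a⟫_ℝ) / ‖a‖ with hs
  have ha' : 0 < ‖a‖ := norm_pos_iff.2 (hA a ha)
  have hs0 : 0 ≤ s := div_nonneg (by linarith [hz a ha]) ha'.le
  have hsτ : s ≤ τ := by
    refine (hmin a₀ ha₀).trans ?_
    rw [div_le_iff₀ (norm_pos_iff.2 (hA a₀ ha₀))]
    linarith
  simp only [Set.mem_iUnion]
  refine ⟨a, ha, z + s • (‖a‖⁻¹ • a), ⟨fun b hb => ?_, ?_⟩, s, ⟨hs0, hsτ⟩, ?_⟩
  · have hb' : 0 < ‖b‖ := norm_pos_iff.2 (hA b hb)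
    have h1 := hmin b hb
    rw [le_div_iff₀ hb'] at h1
    have h2 : ⟪‖a‖⁻¹ • a, b⟫_ℝ ≤ ‖b‖ := by
      refine (real_inner_le_norm _ _).trans (le_of_eq ?_)
      rw [norm_smul, norm_inv, norm_norm, inv_mul_cancel₀ ha'.ne', one_mul]
    rw [inner_add_left, inner_smul_left _ _ s]
    have := mul_le_mul_of_nonneg_left h2 hs0
    simp only [conj_trivial]
    linarith
  · rw [inner_add_left, inner_smul_left, inner_smul_left, real_inner_self_eq_norm_sq, hs]
    simp only [conj_trivial]
    field_simp
    ring
  · simp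

theorem volume_unitBall_ne_zero (n : ℕ) : volume (closedBall (0 : En n) 1) ≠ 0 :=
  (measure_closedBall_pos _ _ one_pos).ne'

theorem volume_unitBall_ne_top (n : ℕ) : volume (closedBall (0 : En n) 1) ≠ ∞ :=
  measure_closedBall_lt_top.ne

/-- A set of finite volume has the volume of a ball. -/
theorem exists_volume_eq_ball {m : ℕ} {s : Set (En (m + 1))} (hs : volume s ≠ ∞) :
    ∃ r : ℝ, 0 ≤ r ∧ volume s =
      ENNReal.ofReal (r ^ (m + 1)) * volume (closedBall (0 : En (m + 1)) 1) := by
  have k0 := volume_unitBall_ne_zero (m + 1)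
  have kt := volume_unitBall_ne_top (m + 1)
  refine ⟨(volume s / volume (closedBall (0 : En (m + 1)) 1)).toReal ^ (((m + 1 : ℕ) : ℝ)⁻¹),
    by positivity, ?_⟩
  rw [Real.rpow_inv_natCast_pow ENNReal.toReal_nonneg (by omega),
    ENNReal.ofReal_toReal (ENNReal.div_ne_top hs k0), ENNReal.div_mul_cancel k0 kt]

open scoped Pointwise in
theorem isoperimetric_polytope_aux {m : ℕ} (A : Finset (En (m + 1))) (hA : ∀ a ∈ A, a ≠ 0)
    {r M τ : ℝ}
    (hr : 0 < r) (hM : ∀ a ∈ A, ‖a‖ ≤ M) (hτ : 0 < τ) (hMτ : M * τ < 1)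
    (hfin : volume {y : En (m + 1) | ∀ a ∈ A, ⟪y, a⟫_ℝ ≤ 1} ≠ ∞)
    (hV : ENNReal.ofReal (r ^ (m + 1)) * volume (closedBall (0 : En (m + 1)) 1) ≤
      volume {y : En (m + 1) | ∀ a ∈ A, ⟪y, a⟫_ℝ ≤ 1}) :
    ENNReal.ofReal ((m + 1) * ((1 - M * τ) * r) ^ m) * volume (closedBall (0 : En (m + 1)) 1) ≤
      ∑ a ∈ A, μHE[m] {y | (∀ b ∈ A, ⟪y, b⟫_ℝ ≤ 1) ∧ ⟪y, a⟫_ℝ = 1} := by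
  set S := ∑ a ∈ A, μHE[m] {y | (∀ b ∈ A, ⟪y, b⟫_ℝ ≤ 1) ∧ ⟪y, a⟫_ℝ = 1} with hS
  set κ := volume (closedBall (0 : En (m + 1)) 1) with hκ
  have k0 : κ ≠ 0 := volume_unitBall_ne_zero (m + 1)
  have kt : κ ≠ ∞ := volume_unitBall_ne_top (m + 1)
  have hstep := volume_polytope_le A hA (τ := τ)
  rw [← hS] at hstep
  set Q := {y : En (m + 1) | ∀ a ∈ A, ⟪y, a⟫_ℝ ≤ 1} with hQ
  set T := {y : En (m + 1) | ∀ a ∈ A, ⟪y, a⟫_ℝ ≤ 1 - τ * ‖a‖} with hT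
  have hTQ : T ⊆ Q := fun y hy a ha => (hy a ha).trans (by
    have := mul_nonneg hτ.le (norm_nonneg a); linarith)
  have hd : Module.finrank ℝ (En (m + 1)) = m + 1 := by simp
  have hTfin : volume T ≠ ∞ := ne_top_of_le_ne_top hfin (measure_mono hTQ)
  obtain ⟨ρ, hρ0, hρ⟩ := exists_volume_eq_ball hTfin
  rw [← hκ] at hρ
  have h1 : 0 < 1 - M * τ := by linarith
  have hρr : (1 - M * τ) * r ≤ ρ := by
    have hsub : (1 - M * τ) • Q ⊆ T := by
      rintro _ ⟨y, hy, rfl⟩ a ha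
      simp only [inner_smul_left, conj_trivial]
      have h2 := mul_le_mul_of_nonneg_left (hy a ha) h1.le
      have h3 := mul_le_mul_of_nonneg_left (hM a ha) hτ.le
      linarith
    have h2 := measure_mono (μ := volume) hsub
    rw [Measure.addHaar_smul, hd, abs_of_pos (by positivity), hρ] at h2
    have h3 : ENNReal.ofReal ((1 - M * τ) ^ (m + 1)) * (ENNReal.ofReal (r ^ (m + 1)) * κ) ≤
        ENNReal.ofReal (ρ ^ (m + 1)) * κ := le_trans (by gcongr) h2
    rw [← mul_assoc, ← ENNReal.ofReal_mul (by positivity), ← mul_pow,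
      ENNReal.mul_le_mul_iff_left k0 kt, ENNReal.ofReal_le_ofReal_iff (by positivity)] at h3
    exact le_of_pow_le_pow_left₀ (by omega) hρ0 h3
  have hρpos : 0 < ρ := lt_of_lt_of_le (by positivity) hρr
  have hBM : ENNReal.ofReal ((ρ + τ) ^ (m + 1)) * κ ≤ volume Q := by
    have hTm : MeasurableSet T := measurableSet_polytope A fun a => 1 - τ * ‖a‖
    have e1 : volume ((ρ / (ρ + τ))⁻¹ • T) = ENNReal.ofReal ((ρ + τ) ^ (m + 1)) * κ := by
      rw [Measure.addHaar_smul, hd, abs_of_pos (by positivity), hρ, ← mul_assoc,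
        ← ENNReal.ofReal_mul (by positivity), ← mul_pow]
      congr 3
      field_simp
    have e2 : volume (closedBall (0 : En (m + 1)) (ρ + τ)) =
        ENNReal.ofReal ((ρ + τ) ^ (m + 1)) * κ := by
      rw [Measure.addHaar_closedBall' _ _ (by positivity), hd]
    rw [← e1]
    refine volume_le_of_smul_add_subset (p := ρ / (ρ + τ)) (q := τ / (ρ + τ)) (by positivity)
      (by positivity) (by field_simp) (hTm.const_smul₀ _) measurableSet_closedBall
      (measurableSet_polytope A fun _ => 1) ?_ (e1.trans e2.symm)
    rintro _ ⟨x, hx, rfl⟩ y hy a ha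
    have h2 := hx a ha
    have h3 : ⟪y, a⟫_ℝ ≤ (ρ + τ) * ‖a‖ := (real_inner_le_norm _ _).trans (by
      gcongr; simpa using hy)
    simp only [smul_smul, inner_add_left, inner_smul_left, conj_trivial]
    rw [mul_inv_cancel₀ (by positivity), one_mul]
    have h4 : τ / (ρ + τ) * ⟪y, a⟫_ℝ ≤ τ * ‖a‖ := by
      refine (mul_le_mul_of_nonneg_left h3 (by positivity)).trans (le_of_eq ?_)
      field_simp
    linarith
  by_cases hSt : S = ∞
  · rw [hSt]; exact le_top
  have h2 := hBM.trans hstep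
  rw [hρ] at h2
  clear_value S κ
  lift S to ℝ≥0 using hSt
  lift κ to ℝ≥0 using kt
  have hk : (0 : ℝ) ≤ κ := κ.2
  rw [← ENNReal.ofReal_coe_nnreal, ← ENNReal.ofReal_coe_nnreal, ← ENNReal.ofReal_mul (by positivity),
    ← ENNReal.ofReal_mul (by positivity), ← ENNReal.ofReal_mul (by positivity),
    ← ENNReal.ofReal_add (by positivity) (by positivity),
    ENNReal.ofReal_le_ofReal_iff (by positivity)] at h2
  rw [← ENNReal.ofReal_coe_nnreal (p := κ), ← ENNReal.ofReal_coe_nnreal (p := S),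
    ← ENNReal.ofReal_mul (by positivity), ENNReal.ofReal_le_ofReal_iff (by positivity)]
  have h3 := pow_add_mul_le_add_pow (a := ρ) (b := τ) hρ0 (by positivity) (m + 1)
  simp only [Nat.add_sub_cancel] at h3
  push_cast at h3
  have h4 : ((m : ℝ) + 1) * ((1 - M * τ) * r) ^ m ≤ (m + 1) * ρ ^ m := by gcongr
  have h5 := mul_le_mul_of_nonneg_right h4 hk
  have h6 := mul_le_mul_of_nonneg_right h3 hk
  have h7 : τ * ((m + 1) * ρ ^ m * κ) ≤ τ * S := by linarith
  exact h5.trans (le_of_mul_le_mul_left h7 hτ)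

theorem isoperimetric_polytope {m : ℕ} (A : Finset (En (m + 1))) (hA : ∀ a ∈ A, a ≠ 0) {r : ℝ}
    (hr : 0 < r) (hfin : volume {y : En (m + 1) | ∀ a ∈ A, ⟪y, a⟫_ℝ ≤ 1} ≠ ∞)
    (hV : ENNReal.ofReal (r ^ (m + 1)) * volume (closedBall (0 : En (m + 1)) 1) ≤
      volume {y : En (m + 1) | ∀ a ∈ A, ⟪y, a⟫_ℝ ≤ 1}) :
    ENNReal.ofReal ((m + 1) * r ^ m) * volume (closedBall (0 : En (m + 1)) 1) ≤
      ∑ a ∈ A, μHE[m] {y | (∀ b ∈ A, ⟪y, b⟫_ℝ ≤ 1) ∧ ⟪y, a⟫_ℝ = 1} := by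
  set M : ℝ := 1 + ∑ a ∈ A, ‖a‖ with hMdef
  have hM : ∀ a ∈ A, ‖a‖ ≤ M := fun a ha =>
    (Finset.single_le_sum (f := fun a => ‖a‖) (fun a _ => norm_nonneg a) ha).trans (by linarith)
  have hM0 : 0 < M := by
    have := Finset.sum_nonneg (s := A) (f := fun a => ‖a‖) fun a _ => norm_nonneg a
    linarith
  have lim : Tendsto (fun τ : ℝ => ENNReal.ofReal ((m + 1) * ((1 - M * τ) * r) ^ m) *
      volume (closedBall (0 : En (m + 1)) 1)) (𝓝[>] 0)
      (𝓝 (ENNReal.ofReal ((m + 1) * r ^ m) * volume (closedBall (0 : En (m + 1)) 1))) := by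
    refine ENNReal.Tendsto.mul_const ?_ (Or.inr (volume_unitBall_ne_top _))
    have hc : Continuous fun τ : ℝ => ENNReal.ofReal ((m + 1) * ((1 - M * τ) * r) ^ m) :=
      ENNReal.continuous_ofReal.comp (by fun_prop)
    have := (hc.tendsto 0).mono_left (nhdsWithin_le_nhds (s := Set.Ioi 0))
    simpa using this
  refine le_of_tendsto lim ?_
  filter_upwards [Ioo_mem_nhdsGT (show (0 : ℝ) < M⁻¹ by positivity)] with τ hτ
  refine isoperimetric_polytope_aux A hA hr hM hτ.1 ?_ hfin hV
  have := mul_lt_mul_of_pos_left hτ.2 hM0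
  rwa [mul_inv_cancel₀ hM0.ne'] at this

/-- Approximation of a convex body from inside by polytopes. -/
theorem exists_polytope {n : ℕ} {K : Set (En n)} (hconv : Convex ℝ K) (hK : IsCompact K)
    (h0 : 0 ∈ interior K) {c : ℝ} (hc : 0 < c) (hc1 : c < 1) :
    ∃ A : Finset (En n), (∀ a ∈ A, a ≠ 0) ∧ {y | ∀ a ∈ A, ⟪y, a⟫_ℝ ≤ 1} ⊆ K ∧
      ∀ y ∈ K, ∀ a ∈ A, ⟪c • y, a⟫_ℝ ≤ 1 := by
  classical
  have hsupp : ∀ x : En n, ∃ a : En n, x ∈ frontier K → a ≠ 0 ∧ 1 < ⟪x, a⟫_ℝ ∧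
      ∀ y ∈ K, ⟪c • y, a⟫_ℝ ≤ 1 := by
    intro x
    by_cases hx : x ∈ frontier K
    · obtain ⟨b, hb, hb'⟩ := exists_support hconv ⟨0, h0⟩ hx
      have hpos := hb' 0 h0
      rw [inner_zero_left] at hpos
      have hval : ⟪x, (c * ⟪x, b⟫_ℝ)⁻¹ • b⟫_ℝ = c⁻¹ := by
        rw [inner_smul_right]; field_simp
      refine ⟨(c * ⟪x, b⟫_ℝ)⁻¹ • b, fun _ => ⟨?_, ?_, fun y hy => ?_⟩⟩
      · intro h
        rw [h, inner_zero_right] at hval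
        exact (inv_pos.2 hc).ne hval
      · rw [hval]; exact (one_lt_inv₀ hc).2 hc1
      · have := hb y hy
        rw [inner_smul_left, inner_smul_right]
        simp only [conj_trivial]
        rw [← mul_assoc, mul_inv, ← mul_assoc, mul_inv_cancel₀ hc.ne', one_mul,
          inv_mul_le_iff₀ hpos]
        linarith
    · exact ⟨0, fun h => absurd h hx⟩
  choose a ha using hsupp
  have hfc : IsCompact (frontier K) :=
    hK.of_isClosed_subset isClosed_frontier hK.isClosed.frontier_subset
  obtain ⟨t, ht, hcov⟩ := hfc.elim_nhds_subcover (fun x => {y | 1 < ⟪y, a x⟫_ℝ}) fun x hx =>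
    (isOpen_lt (by fun_prop) (by fun_prop)).mem_nhds (ha x hx).2.1
  refine ⟨t.image a, ?_, ?_, ?_⟩
  · simp only [Finset.mem_image, forall_exists_index, and_imp, forall_apply_eq_imp_iff₂]
    exact fun x hx => (ha x (ht x hx)).1
  · refine (IsPreconnected.subset_left_of_subset_union isOpen_interior hK.isClosed.isOpen_compl
      (Set.disjoint_left.2 fun x h1 h2 => h2 (interior_subset h1)) ?_ ⟨0, ?_, h0⟩
      (Convex.isPreconnected ?_)).trans interior_subset
    · intro y hy
      by_contra h1
      simp only [Set.mem_union, Set.mem_compl_iff, not_or, not_not] at h1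
      have hyf : y ∈ frontier K := by
        rw [hK.isClosed.frontier_eq]; exact ⟨h1.2, h1.1⟩
      obtain ⟨x, hx, hxy⟩ := Set.mem_iUnion₂.1 (hcov hyf)
      exact absurd (hy (a x) (Finset.mem_image_of_mem a hx)) (not_le.2 hxy)
    · intro b _
      simp
    · intro x hx y hy p q hp hq hpq b hb
      rw [inner_add_left, inner_smul_left, inner_smul_left]
      have h1 := mul_le_mul_of_nonneg_left (hx b hb) hp
      have h2 := mul_le_mul_of_nonneg_left (hy b hb) hq
      simp only [conj_trivial]
      linarith
  · simp only [Finset.mem_image, forall_exists_index, and_imp, forall_apply_eq_imp_iff₂]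
    exact fun y hy x hx => (ha x (ht x hx)).2.2 y hy

open scoped Pointwise in
theorem isoperimetric_of_zero_mem {m : ℕ} {K : Set (En (m + 1))} (hconv : Convex ℝ K)
    (hK : IsCompact K) (h0 : 0 ∈ interior K) {r : ℝ} (hr : 0 < r)
    (hV : volume K = ENNReal.ofReal (r ^ (m + 1)) * volume (closedBall (0 : En (m + 1)) 1)) :
    ENNReal.ofReal ((m + 1) * r ^ m) * volume (closedBall (0 : En (m + 1)) 1) ≤
      μHE[m] (frontier K) := by
  have lim : Tendsto (fun c : ℝ => ENNReal.ofReal ((m + 1) * (c * r) ^ m) *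
      volume (closedBall (0 : En (m + 1)) 1)) (𝓝[<] 1)
      (𝓝 (ENNReal.ofReal ((m + 1) * r ^ m) * volume (closedBall (0 : En (m + 1)) 1))) := by
    refine ENNReal.Tendsto.mul_const ?_ (Or.inr (volume_unitBall_ne_top _))
    have hc : Continuous fun c : ℝ => ENNReal.ofReal ((m + 1) * (c * r) ^ m) :=
      ENNReal.continuous_ofReal.comp (by fun_prop)
    have := (hc.tendsto 1).mono_left (nhdsWithin_le_nhds (s := Set.Iio 1))
    simpa using this
  refine le_of_tendsto lim ?_
  filter_upwards [Ioo_mem_nhdsLT (show (0 : ℝ) < 1 by norm_num)] with c hc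
  have hc0 := hc.1
  obtain ⟨A, hA, hAK, hKA⟩ := exists_polytope hconv hK h0 hc.1 hc.2
  refine (isoperimetric_polytope A hA (by positivity)
    (ne_top_of_le_ne_top hK.measure_lt_top.ne (measure_mono hAK)) ?_).trans
    (facets_le_frontier hK A hA hAK)
  have hsub : c • K ⊆ {y : En (m + 1) | ∀ a ∈ A, ⟪y, a⟫_ℝ ≤ 1} := by
    rintro _ ⟨y, hy, rfl⟩
    exact hKA y hy
  refine le_trans (le_of_eq ?_) (measure_mono hsub)
  rw [Measure.addHaar_smul, show Module.finrank ℝ (En (m + 1)) = m + 1 by simp,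
    abs_of_pos (by positivity), hV, ← mul_assoc, ← ENNReal.ofReal_mul (by positivity), ← mul_pow]

/-- The isoperimetric inequality for convex bodies. -/
theorem isoperimetric {m : ℕ} {K : Set (En (m + 1))} (hconv : Convex ℝ K)
    (hK : IsCompact K) (hint : (interior K).Nonempty) {r : ℝ} (hr : 0 < r)
    (hV : volume K = ENNReal.ofReal (r ^ (m + 1)) * volume (closedBall (0 : En (m + 1)) 1)) :
    ENNReal.ofReal ((m + 1) * r ^ m) * volume (closedBall (0 : En (m + 1)) 1) ≤
      μHE[m] (frontier K) := by
  obtain ⟨c, hc⟩ := hint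
  have h := isoperimetric_of_zero_mem (K := Homeomorph.addRight (-c) '' K) ?_ ?_ ?_ hr ?_
  · rw [← Homeomorph.image_frontier] at h
    exact h.trans_eq ((IsometryEquiv.addRight (-c)).isometry.euclideanHausdorffMeasure_image _)
  · rw [Homeomorph.image_eq_preimage_symm]
    exact hconv.translate_preimage_left _
  · exact hK.image (Homeomorph.continuous _)
  · rw [← Homeomorph.image_interior]
    exact ⟨c, hc, by simp⟩
  · rw [← hV]
    simp

/-- A polytope with all facets at distance at least `c` from the origin has surface area at most
`(m + 1) / c` times its volume. -/
theorem facets_le_volume {m : ℕ} (A : Finset (En (m + 1))) (hA : ∀ a ∈ A, a ≠ 0) {c : ℝ}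
    (hAc : ∀ a ∈ A, c * ‖a‖ ≤ 1) :
    ENNReal.ofReal (c / (m + 1)) *
      ∑ a ∈ A, μHE[m] {y | (∀ b ∈ A, ⟪y, b⟫_ℝ ≤ 1) ∧ ⟪y, a⟫_ℝ = 1} ≤
      volume {y : En (m + 1) | ∀ a ∈ A, ⟪y, a⟫_ℝ ≤ 1} := by
  have cone : ∀ a ∈ A, ENNReal.ofReal (c / (m + 1)) *
      μHE[m] {y | (∀ b ∈ A, ⟪y, b⟫_ℝ ≤ 1) ∧ ⟪y, a⟫_ℝ = 1} ≤
      volume {z | 0 < ⟪z, a⟫_ℝ ∧ ⟪z, a⟫_ℝ ≤ 1 ∧ ∀ b ∈ A, ⟪z, b - a⟫_ℝ ≤ 0} := by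
    intro a ha
    have ha' : 0 < ‖a‖ := norm_pos_iff.2 (hA a ha)
    have h := volume_cone (m := m) (u := ‖a‖⁻¹ • a) (by simp [norm_smul, ha'.ne']) (h := ‖a‖⁻¹)
      (by positivity) (D := {y | (∀ b ∈ A, ⟪y, b⟫_ℝ ≤ 1) ∧ ⟪y, a⟫_ℝ = 1})
      ((measurableSet_polytope A fun _ => 1).inter
        (isClosed_eq (by fun_prop) (by fun_prop)).measurableSet)
      (fun y hy => by rw [inner_smul_right, hy.2, mul_one])
    calc _ ≤ ENNReal.ofReal (‖a‖⁻¹ / (m + 1)) *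
          μHE[m] {y | (∀ b ∈ A, ⟪y, b⟫_ℝ ≤ 1) ∧ ⟪y, a⟫_ℝ = 1} := by
          gcongr
          rw [← one_div, le_div_iff₀ ha']
          exact hAc a ha
      _ = _ := h.symm
      _ ≤ _ := by
          refine measure_mono ?_
          rintro _ ⟨t, ⟨ht0, ht1⟩, q, ⟨hq, hqa⟩, rfl⟩
          simp only [Set.mem_ofPred_eq, inner_smul_left, conj_trivial, hqa, mul_one,
            inner_sub_right]
          exact ⟨ht0, ht1, fun b hb => by linarith [mul_le_mul_of_nonneg_left (hq b hb) ht0.le]⟩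
  rw [Finset.mul_sum]
  refine (Finset.sum_le_sum cone).trans ?_
  rw [← measure_biUnion_finset₀]
  · refine measure_mono (Set.iUnion₂_subset fun a ha z hz b hb => ?_)
    have := hz.2.2 b hb
    rw [inner_sub_right] at this
    linarith [hz.2.1]
  · intro a ha b hb hab
    refine measure_mono_null ?_ (volume_hyperplane (sub_ne_zero.2 hab) 0)
    rintro z ⟨h1, h2⟩
    have h3 := h1.2.2 b hb
    have h4 := h2.2.2 a ha
    simp only [Set.mem_ofPred_eq, inner_sub_right] at *
    linarith
  · intro a ha
    refine MeasurableSet.nullMeasurableSet ?_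
    have h0 : MeasurableSet {z : En (m + 1) | 0 < ⟪z, a⟫_ℝ} :=
      (isOpen_lt (by fun_prop) (by fun_prop)).measurableSet
    have h1 : MeasurableSet {z : En (m + 1) | ⟪z, a⟫_ℝ ≤ 1} :=
      (isClosed_le (by fun_prop) (by fun_prop)).measurableSet
    have : {z : En (m + 1) | ∀ b ∈ A, ⟪z, b - a⟫_ℝ ≤ 0} = ⋂ b ∈ A, {z | ⟪z, b - a⟫_ℝ ≤ 0} := by
      ext; simp
    have h2 : MeasurableSet {z : En (m + 1) | ∀ b ∈ A, ⟪z, b - a⟫_ℝ ≤ 0} := by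
      rw [this]
      exact Finset.measurableSet_biInter _ fun b _ =>
        (isClosed_le (by fun_prop) (by fun_prop)).measurableSet
    exact h0.inter (h1.inter h2)

/-- A ball inside a bounded polytope has smaller surface area. -/
theorem sphere_le_facets {m : ℕ} (A : Finset (En (m + 1))) {c : ℝ} (hc : 0 < c)
    (hbd : {y : En (m + 1) | ∀ a ∈ A, ⟪y, a⟫_ℝ ≤ 1} ⊆ closedBall 0 1)
    (hAc : ∀ a ∈ A, c * ‖a‖ ≤ 1) :
    μHE[m] (sphere (0 : En (m + 1)) c) ≤
      ∑ a ∈ A, μHE[m] {y : En (m + 1) | (∀ b ∈ A, ⟪y, b⟫_ℝ ≤ 1) ∧ ⟪y, a⟫_ℝ = 1} := by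
  refine le_trans ?_ (measure_biUnion_finset_le A _)
  refine euclideanHausdorffMeasure_le_of_nearest m sphere_subset_closedBall fun p hp => ?_
  have hpc : ‖p‖ = c := by simpa using hp
  have hex : ∃ a ∈ A, 0 < ⟪p, a⟫_ℝ := by
    by_contra! hcon
    have : (2 / c) • p ∈ {y : En (m + 1) | ∀ a ∈ A, ⟪y, a⟫_ℝ ≤ 1} := by
      intro a ha
      rw [inner_smul_left]
      have := mul_nonpos_of_nonneg_of_nonpos (show 0 ≤ 2 / c by positivity) (hcon a ha)
      exact this.trans zero_le_one
    have h2 := hbd this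
    rw [mem_closedBall_zero_iff, norm_smul, hpc, Real.norm_of_nonneg (by positivity),
      div_mul_cancel₀ _ hc.ne'] at h2
    norm_num at h2
  obtain ⟨a₀, ha₀, hpos⟩ := hex
  obtain ⟨a, ha, hmax⟩ := A.exists_max_image (fun a => ⟪p, a⟫_ℝ) ⟨a₀, ha₀⟩
  have hpa : 0 < ⟪p, a⟫_ℝ := hpos.trans_le (hmax a₀ ha₀)
  have hpa1 : ⟪p, a⟫_ℝ ≤ 1 := (real_inner_le_norm _ _).trans (by rw [hpc]; exact hAc a ha)
  refine ⟨(⟪p, a⟫_ℝ)⁻¹ • p, Set.mem_iUnion₂.2 ⟨a, ha, fun b hb => ?_, ?_⟩, fun z hz => ?_⟩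
  · rw [inner_smul_left]
    exact (inv_mul_le_one₀ hpa).2 (hmax b hb)
  · rw [inner_smul_left]
    exact inv_mul_cancel₀ hpa.ne'
  · have h1 : 1 ≤ (⟪p, a⟫_ℝ)⁻¹ := (one_le_inv₀ hpa).2 hpa1
    have h2 : (⟪p, a⟫_ℝ)⁻¹ • p - p = ((⟪p, a⟫_ℝ)⁻¹ - 1) • p := by rw [sub_smul, one_smul]
    rw [h2, inner_smul_left, inner_sub_right, real_inner_self_eq_norm_sq]
    refine mul_nonpos_of_nonneg_of_nonpos (sub_nonneg.2 h1) ?_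
    have h3 := real_inner_le_norm p z
    have h4 : ‖z‖ ≤ c := by simpa using hz
    rw [hpc] at *
    nlinarith

open scoped Pointwise in
/-- The surface area of the unit sphere is at most `m + 1` times the volume of the ball. -/
theorem sphere_area_le {m : ℕ} :
    μHE[m] (sphere (0 : En (m + 1)) 1) ≤
      ENNReal.ofReal (m + 1) * volume (closedBall (0 : En (m + 1)) 1) := by
  set σ := μHE[m] (sphere (0 : En (m + 1)) 1) with hσ
  have key : ∀ c ∈ Set.Ioo (0 : ℝ) 1, ENNReal.ofReal (c ^ (m + 1) / (m + 1)) * σ ≤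
      volume (closedBall (0 : En (m + 1)) 1) := by
    intro c ⟨hc0, hc1⟩
    obtain ⟨A, hA, hAK, hKA⟩ := exists_polytope (convex_closedBall (0 : En (m + 1)) 1)
      (isCompact_closedBall _ _) (by rw [interior_closedBall _ one_ne_zero]; simp) hc0 hc1
    have hAc : ∀ a ∈ A, c * ‖a‖ ≤ 1 := by
      intro a ha
      have ha' : 0 < ‖a‖ := norm_pos_iff.2 (hA a ha)
      have h := hKA (‖a‖⁻¹ • a) (by simp [norm_smul, ha'.ne']) a ha
      rw [inner_smul_left, inner_smul_left, real_inner_self_eq_norm_sq] at h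
      simp only [conj_trivial] at h
      have : c * (‖a‖⁻¹ * ‖a‖ ^ 2) = c * ‖a‖ := by field_simp
      rwa [this] at h
    have hs : ENNReal.ofReal (c ^ m) * σ = μHE[m] (sphere (0 : En (m + 1)) c) := by
      have : sphere (0 : En (m + 1)) c = c • sphere (0 : En (m + 1)) 1 := by
        rw [_root_.smul_sphere' hc0.ne', smul_zero, Real.norm_of_nonneg hc0.le, mul_one]
      rw [this, Measure.euclideanHausdorffMeasure_smul₀ m hc0.ne', ENNReal.smul_def, smul_eq_mul,
        ENNReal.ofReal_pow hc0.le, ENNReal.coe_pow, ← Real.enorm_of_nonneg hc0.le]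
      rfl
    calc _ = ENNReal.ofReal (c / (m + 1)) * (ENNReal.ofReal (c ^ m) * σ) := by
          rw [← mul_assoc, ← ENNReal.ofReal_mul (by positivity)]
          congr 2
          ring
      _ ≤ ENNReal.ofReal (c / (m + 1)) * ∑ a ∈ A,
          μHE[m] {y : En (m + 1) | (∀ b ∈ A, ⟪y, b⟫_ℝ ≤ 1) ∧ ⟪y, a⟫_ℝ = 1} := by
          rw [hs]; gcongr; exact sphere_le_facets A hc0 hAK hAc
      _ ≤ _ := facets_le_volume A hA hAc
      _ ≤ _ := measure_mono hAK
  have lim : Tendsto (fun c : ℝ => ENNReal.ofReal (c ^ (m + 1) / (m + 1)) * σ) (𝓝[<] 1)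
      (𝓝 (ENNReal.ofReal (1 ^ (m + 1) / (m + 1)) * σ)) := by
    refine ENNReal.Tendsto.mul_const ?_ (Or.inl ?_)
    · have hc : Continuous fun c : ℝ => ENNReal.ofReal (c ^ (m + 1) / (m + 1)) :=
        ENNReal.continuous_ofReal.comp (by fun_prop)
      exact (hc.tendsto 1).mono_left (nhdsWithin_le_nhds (s := Set.Iio 1))
    · rw [ENNReal.ofReal_ne_zero_iff]; positivity
  have h := le_of_tendsto lim (by
    filter_upwards [Ioo_mem_nhdsLT (show (0 : ℝ) < 1 by norm_num)] with c hc using key c hc)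
  calc σ = ENNReal.ofReal (m + 1) * (ENNReal.ofReal (1 ^ (m + 1) / (m + 1)) * σ) := by
        rw [← mul_assoc, ← ENNReal.ofReal_mul (by positivity), one_pow,
          mul_one_div_cancel (by positivity),
          ENNReal.ofReal_one, one_mul]
    _ ≤ _ := by gcongr

/-- The orthogonal projection of `K` along the unit vector `v`. -/
def shadow {n : ℕ} (v : En n) (K : Set (En n)) : Set (En n) := (fun y => y - ⟪y, v⟫_ℝ • v) '' K

theorem isCompact_shadow {n : ℕ} (v : En n) {K : Set (En n)} (hK : IsCompact K) :
    IsCompact (shadow v K) := hK.image (by fun_prop)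

/-- The boundary points of `K` having an outer normal vector in `ω`. -/
def reverseGauss {n : ℕ} (K : Set (En n)) (ω : Set (Sph n)) : Set (En n) :=
  {x ∈ frontier K | ∃ u ∈ ω, ∀ y ∈ K, ⟪y - x, (u : En n)⟫_ℝ ≤ 0}

theorem isCompact_reverseGauss {n : ℕ} {K : Set (En n)} (hK : IsCompact K) {ω : Set (Sph n)}
    (hω : IsCompact ω) : IsCompact (reverseGauss K ω) := by
  have hF : IsCompact (frontier K) := hK.of_isClosed_subset isClosed_frontier
    hK.isClosed.frontier_subset
  have hc : IsClosed {p : En n × Sph n | ∀ y ∈ K, ⟪y - p.1, (p.2 : En n)⟫_ℝ ≤ 0} := by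
    simp only [Set.ofPred_forall]
    exact isClosed_biInter fun y _ => isClosed_le (by fun_prop) (by fun_prop)
  have := ((hF.prod hω).inter_right hc).image continuous_fst
  convert this using 1
  ext x
  constructor
  · rintro ⟨hx, u, hu, h⟩
    exact ⟨(x, u), ⟨⟨hx, hu⟩, h⟩, rfl⟩
  · rintro ⟨⟨x, u⟩, ⟨⟨hx, hu⟩, h⟩, rfl⟩
    exact ⟨hx, u, hu, h⟩

theorem reverseGauss_union {n : ℕ} (K : Set (En n)) (ω ω' : Set (Sph n)) :
    reverseGauss K (ω ∪ ω') = reverseGauss K ω ∪ reverseGauss K ω' := by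
  ext x
  simp only [reverseGauss, Set.mem_ofPred_eq, Set.mem_union, ← and_or_left]
  refine and_congr_right fun _ => ?_
  constructor
  · rintro ⟨u, hu | hu, h⟩
    exacts [.inl ⟨u, hu, h⟩, .inr ⟨u, hu, h⟩]
  · rintro (⟨u, hu, h⟩ | ⟨u, hu, h⟩)
    exacts [⟨u, .inl hu, h⟩, ⟨u, .inr hu, h⟩]

/-- Projecting along `v` a subset of the hyperplane orthogonal to `u` scales its area
by `⟪v, u⟫`. -/
theorem area_shadow_of_subset_hyperplane {m : ℕ} {u v : En (m + 1)} (hu : ‖u‖ = 1) (hv : ‖v‖ = 1)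
    (huv : 0 < ⟪v, u⟫_ℝ) {D : Set (En (m + 1))} (hD : IsCompact D) (hDu : ∀ y ∈ D, ⟪y, u⟫_ℝ = 0) :
    μHE[m] (shadow v D) = ENNReal.ofReal ⟪v, u⟫_ℝ * μHE[m] D := by
  have hvv : ⟪v, v⟫_ℝ = 1 := by rw [real_inner_self_eq_norm_sq, hv, one_pow]
  have h1 := volume_prism (m := m) hu huv (h := 0) (τ := 1) hD.measurableSet hDu
  have h2 := volume_prism (m := m) hv (w := v) (by rw [hvv]; exact one_pos) (h := 0) (τ := 1)
    (isCompact_shadow v hD).measurableSet (by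
      rintro _ ⟨y, _, rfl⟩
      simp only [inner_sub_left, inner_smul_left, hvv, conj_trivial, mul_one, sub_self])
  rw [one_mul] at h1 h2
  rw [hvv, ENNReal.ofReal_one, one_mul] at h2
  set f : Module.Dual ℝ (En (m + 1)) :=
    (innerSL ℝ (v - (⟪v, u⟫_ℝ)⁻¹ • u) : En (m + 1) →L[ℝ] ℝ).toLinearMap with hf
  have hfa : ∀ z, f z = ⟪z, v⟫_ℝ - (⟪v, u⟫_ℝ)⁻¹ * ⟪z, u⟫_ℝ := by
    intro z
    simp only [hf, ContinuousLinearMap.coe_coe, innerSL_apply_apply, inner_sub_left,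
      inner_smul_left, conj_trivial]
    rw [real_inner_comm z v, real_inner_comm z u]
  have hfv : f v = 0 := by rw [hfa, hvv, inv_mul_cancel₀ huv.ne', sub_self]
  have hdet : LinearMap.det (LinearMap.transvection f v) = 1 := by
    rw [LinearMap.transvection.det, hfv, add_zero]
  have himg : LinearMap.transvection f v '' {z | ∃ q ∈ shadow v D, ∃ t ∈ Set.Icc (0 : ℝ) 1,
      z = q + t • v} = {z | ∃ q ∈ D, ∃ t ∈ Set.Icc (0 : ℝ) 1, z = q + t • v} := by
    have hq : ∀ q ∈ D, ∀ t : ℝ,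
        LinearMap.transvection f v (q - ⟪q, v⟫_ℝ • v + t • v) = q + t • v := by
      intro q hq t
      rw [LinearMap.transvection.apply, map_add, map_sub, map_smul, map_smul, hfv, smul_zero,
        smul_zero, sub_zero, add_zero, hfa, hDu q hq]
      module
    ext z
    constructor
    · rintro ⟨_, ⟨_, ⟨q, hqD, rfl⟩, t, ht, rfl⟩, rfl⟩
      exact ⟨q, hqD, t, ht, hq q hqD t⟩
    · rintro ⟨q, hqD, t, ht, rfl⟩
      exact ⟨_, ⟨_, ⟨q, hqD, rfl⟩, t, ht, rfl⟩, hq q hqD t⟩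
  have h3 := Measure.addHaar_image_linearMap volume (LinearMap.transvection f v)
    {z | ∃ q ∈ shadow v D, ∃ t ∈ Set.Icc (0 : ℝ) 1, z = q + t • v}
  rw [himg, hdet, abs_one, ENNReal.ofReal_one, one_mul, h1, h2] at h3
  exact h3.symm

/-- Projecting along `v` a set which is almost orthogonal to `u` scales its area by
almost `⟪v, u⟫`. -/
theorem area_le_area_shadow {m : ℕ} {u v : En (m + 1)} (hu : ‖u‖ = 1) (hv : ‖v‖ = 1)
    (huv : 0 < ⟪v, u⟫_ℝ) {c : ℝ} (hc : 0 < c) {A : Set (En (m + 1))} (hA : IsCompact A)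
    (h : ∀ x ∈ A, ∀ x' ∈ A, |⟪x - x', u⟫_ℝ| ≤ (1 - c) * ⟪v, u⟫_ℝ * ‖x - x'‖) :
    ENNReal.ofReal (c ^ m) * (ENNReal.ofReal ⟪v, u⟫_ℝ * μHE[m] A) ≤ μHE[m] (shadow v A) := by
  set Q : En (m + 1) → En (m + 1) := fun z => z - (⟪z, u⟫_ℝ / ⟪v, u⟫_ℝ) • v with hQ
  have hQA : IsCompact (Q '' A) := hA.image (by fun_prop)
  have h1 := area_shadow_of_subset_hyperplane hu hv huv hQA (by
    rintro _ ⟨z, _, rfl⟩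
    simp only [hQ, inner_sub_left, inner_smul_left, conj_trivial]
    field_simp
    simp)
  have h2 : shadow v (Q '' A) = shadow v A := by
    have hvv : ⟪v, v⟫_ℝ = 1 := by rw [real_inner_self_eq_norm_sq, hv, one_pow]
    rw [shadow, shadow, Set.image_image]
    refine Set.image_congr fun z _ => ?_
    simp only [hQ, inner_sub_left, inner_smul_left, conj_trivial, hvv]
    module
  rw [h2] at h1
  have h3 : μHE[m] A ≤ ((Real.toNNReal c⁻¹ : ℝ≥0) : ℝ≥0∞) ^ m * μHE[m] (Q '' A) := by
    refine euclideanHausdorffMeasure_le_of_relation m (fun x y => x = Q y)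
      (fun y hy => ⟨_, ⟨y, hy, rfl⟩, rfl⟩) ?_
    rintro x - x' - y hy y' hy' rfl rfl
    rw [Real.coe_toNNReal _ (by positivity), ← div_eq_inv_mul, le_div_iff₀ hc]
    have e : Q y - Q y' = (y - y') - (⟪y - y', u⟫_ℝ / ⟪v, u⟫_ℝ) • v := by
      simp only [hQ, inner_sub_left]
      module
    have h4 := norm_sub_norm_le (y - y') ((⟪y - y', u⟫_ℝ / ⟪v, u⟫_ℝ) • v)
    rw [norm_smul, hv, mul_one, Real.norm_eq_abs, abs_div, abs_of_pos huv, ← e] at h4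
    have h5 : |⟪y - y', u⟫_ℝ| / ⟪v, u⟫_ℝ ≤ (1 - c) * ‖y - y'‖ := by
      rw [div_le_iff₀ huv]
      linarith [h y hy y' hy']
    linarith
  calc _ ≤ ENNReal.ofReal (c ^ m) * (ENNReal.ofReal ⟪v, u⟫_ℝ *
        (((Real.toNNReal c⁻¹ : ℝ≥0) : ℝ≥0∞) ^ m * μHE[m] (Q '' A))) := by gcongr
    _ = (ENNReal.ofReal (c ^ m) * ((Real.toNNReal c⁻¹ : ℝ≥0) : ℝ≥0∞) ^ m) *
        (ENNReal.ofReal ⟪v, u⟫_ℝ * μHE[m] (Q '' A)) := by ring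
    _ = _ := by
      rw [← h1]
      change ENNReal.ofReal (c ^ m) * (ENNReal.ofReal c⁻¹) ^ m * _ = _
      rw [← ENNReal.ofReal_pow (by positivity), ← ENNReal.ofReal_mul (by positivity), ← mul_pow,
        mul_inv_cancel₀ hc.ne', one_pow, ENNReal.ofReal_one, one_mul]

/-- Along a line in direction `v`, a convex body has only one boundary point with an outer normal
making an acute angle with `v`. -/
theorem eq_of_mem_reverseGauss {n : ℕ} {K : Set (En n)} (hK : IsClosed K) {v : En n}
    {ω ω' : Set (Sph n)} (hω : ∀ u ∈ ω, 0 < ⟪v, (u : En n)⟫_ℝ)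
    (hω' : ∀ u ∈ ω', 0 < ⟪v, (u : En n)⟫_ℝ) {x x' : En n} (hx : x ∈ reverseGauss K ω)
    (hx' : x' ∈ reverseGauss K ω') {s : ℝ} (h : x = x' + s • v) : x = x' := by
  obtain ⟨hxF, u, hu, hxu⟩ := hx
  obtain ⟨hxF', u', hu', hxu'⟩ := hx'
  have h1 := hxu x' (hK.frontier_subset hxF')
  have h2 := hxu' x (hK.frontier_subset hxF)
  have e1 : x' - x = (-s) • v := by rw [h]; module
  have e2 : x - x' = s • v := by rw [h]; module
  rw [e1, inner_smul_left, conj_trivial] at h1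
  rw [e2, inner_smul_left, conj_trivial] at h2
  have h3 : 0 ≤ s := by
    by_contra! hs
    have := mul_pos (neg_pos.2 hs) (hω u hu)
    linarith
  have h4 : s ≤ 0 := by
    by_contra! hs
    have := mul_pos hs (hω' u' hu')
    linarith
  rw [h, le_antisymm h4 h3, zero_smul, add_zero]

theorem area_shadow_inter {m : ℕ} {K : Set (En (m + 1))} (hK : IsCompact K) {v : En (m + 1)}
    {μ : Measure (Sph (m + 1))} [IsFiniteMeasure μ]
    (hμ : ∀ ω, MeasurableSet ω → μ ω = μHE[m] (reverseGauss K ω)) {ω ω' : Set (Sph (m + 1))}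
    (hωc : IsCompact ω) (hωc' : IsCompact ω') (hd : Disjoint ω ω')
    (hω : ∀ u ∈ ω, 0 < ⟪v, (u : En (m + 1))⟫_ℝ) (hω' : ∀ u ∈ ω', 0 < ⟪v, (u : En (m + 1))⟫_ℝ)
    (hv : ‖v‖ = 1) :
    μHE[m] (shadow v (reverseGauss K ω) ∩ shadow v (reverseGauss K ω')) = 0 := by
  have h0 : μHE[m] (reverseGauss K ω ∩ reverseGauss K ω') = 0 := by
    have h := measure_union_add_inter (μ := (μHE[m] : Measure (En (m + 1)))) (reverseGauss K ω)
      (isCompact_reverseGauss hK hωc').measurableSet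
    rw [← reverseGauss_union, ← hμ _ hωc.measurableSet, ← hμ _ hωc'.measurableSet,
      ← hμ _ (hωc.measurableSet.union hωc'.measurableSet),
      measure_union hd hωc'.measurableSet] at h
    have hfin : μ ω + μ ω' ≠ ∞ := ENNReal.add_ne_top.2 ⟨measure_ne_top _ _, measure_ne_top _ _⟩
    exact (ENNReal.add_right_inj hfin).1 (h.trans (add_zero _).symm)
  have h1 : shadow v (reverseGauss K ω) ∩ shadow v (reverseGauss K ω') ⊆
      shadow v (reverseGauss K ω ∩ reverseGauss K ω') := by
    rintro _ ⟨⟨x, hx, rfl⟩, ⟨x', hx', h⟩⟩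
    have h' : x = x' + (⟪x, v⟫_ℝ - ⟪x', v⟫_ℝ) • v := by
      simp only at h
      rw [sub_smul, ← sub_eq_zero]
      have := sub_eq_zero.2 h
      rw [← neg_eq_zero, ← this]
      abel
    have e := eq_of_mem_reverseGauss hK.isClosed hω hω' hx hx' h'
    exact ⟨x, ⟨hx, e ▸ hx'⟩, rfl⟩
  refine measure_mono_null h1 (le_antisymm ?_ bot_le)
  have h2 := euclideanHausdorffMeasure_le_of_relation (C := 1) m
    (s := reverseGauss K ω ∩ reverseGauss K ω')
    (t := shadow v (reverseGauss K ω ∩ reverseGauss K ω'))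
    (fun x y => y = x - ⟪x, v⟫_ℝ • v) (by rintro _ ⟨x, hx, rfl⟩; exact ⟨x, hx, rfl⟩) (by
      rintro x - x' - _ - _ - rfl rfl
      have e : x - ⟪x, v⟫_ℝ • v - (x' - ⟪x', v⟫_ℝ • v) = (x - x') - ⟪x - x', v⟫_ℝ • v := by
        rw [inner_sub_left]; module
      rw [e, NNReal.coe_one, one_mul]
      refine le_of_sq_le_sq ?_ (norm_nonneg _)
      rw [norm_sub_sq_real, inner_smul_right, norm_smul, hv, mul_one, Real.norm_eq_abs, sq_abs]
      nlinarith [sq_nonneg ⟪x - x', v⟫_ℝ])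
  rwa [h0, mul_zero] at h2

/-- The pieces of the boundary with almost constant normal vectors have disjoint shadows. -/
theorem sum_area_le_area_shadow {m : ℕ} {K : Set (En (m + 1))} (hK : IsCompact K)
    {v : En (m + 1)} (hv : ‖v‖ = 1) {μ : Measure (Sph (m + 1))} [IsFiniteMeasure μ]
    (hμ : ∀ ω, MeasurableSet ω → μ ω = μHE[m] (reverseGauss K ω)) {N : ℕ}
    {c η : ℝ} (hc : 0 < c) (hc1 : c < 1) (hη : 0 < η) (p : Fin N → Sph (m + 1))
    (hp : ∀ i, η ≤ ⟪v, (p i : En (m + 1))⟫_ℝ) (ω : Fin N → Set (Sph (m + 1)))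
    (hω : ∀ i, IsCompact (ω i)) (hpω : ∀ i, ω i ⊆ ball (p i) ((1 - c) * η))
    (hd : Pairwise (Function.onFun Disjoint ω)) :
    ∑ i, ENNReal.ofReal (c ^ m) * (ENNReal.ofReal ⟪v, (p i : En (m + 1))⟫_ℝ * μ (ω i)) ≤
      μHE[m] (shadow v K) := by
  have hpos : ∀ i, ∀ u ∈ ω i, 0 < ⟪v, (u : En (m + 1))⟫_ℝ := by
    intro i u hu
    have h1 : ‖(u : En (m + 1)) - p i‖ < (1 - c) * η := by
      rw [← dist_eq_norm]; exact hpω i hu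
    have h2 := real_inner_le_norm v ((p i : En (m + 1)) - u)
    rw [hv, one_mul, norm_sub_rev, inner_sub_right] at h2
    nlinarith [hp i]
  have hle : ∀ i, ENNReal.ofReal (c ^ m) * (ENNReal.ofReal ⟪v, (p i : En (m + 1))⟫_ℝ * μ (ω i)) ≤
      μHE[m] (shadow v (reverseGauss K (ω i))) := by
    intro i
    rw [hμ _ (hω i).measurableSet]
    refine area_le_area_shadow (mem_sphere_zero_iff_norm.1 (p i).2) hv (hη.trans_le (hp i)) hc
      (isCompact_reverseGauss hK (hω i)) ?_
    have key : ∀ x ∈ reverseGauss K (ω i), ∀ x' ∈ K,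
        ⟪x' - x, (p i : En (m + 1))⟫_ℝ ≤ (1 - c) * ⟪v, (p i : En (m + 1))⟫_ℝ * ‖x' - x‖ := by
      rintro x ⟨hx, u, hu, h⟩ x' hx'
      have h1 : ‖(p i : En (m + 1)) - u‖ < (1 - c) * η := by
        rw [norm_sub_rev, ← dist_eq_norm]; exact hpω i hu
      have h2 := real_inner_le_norm (x' - x) ((p i : En (m + 1)) - u)
      rw [inner_sub_right] at h2
      have h3 := h x' hx'
      have h4 : (1 - c) * η ≤ (1 - c) * ⟪v, (p i : En (m + 1))⟫_ℝ :=
        mul_le_mul_of_nonneg_left (hp i) (by linarith)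
      have h5 := mul_le_mul_of_nonneg_left (h1.le.trans h4) (norm_nonneg (x' - x))
      linarith
    intro x hx x' hx'
    rw [abs_le]
    have h1 := key x hx x' (hK.isClosed.frontier_subset hx'.1)
    have h2 := key x' hx' x (hK.isClosed.frontier_subset hx.1)
    rw [norm_sub_rev, ← neg_sub, inner_neg_left] at h1
    exact ⟨by linarith, h2⟩
  refine (Finset.sum_le_sum fun i _ => hle i).trans ?_
  rw [← measure_biUnion_finset₀]
  · refine measure_mono (Set.iUnion₂_subset fun i _ => Set.image_mono ?_)
    exact fun x hx => hK.isClosed.frontier_subset hx.1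
  · intro i _ j _ hij
    exact area_shadow_inter hK hμ (hω i) (hω j) (hd hij) (hpos i) (hpos j) hv
  · exact fun i _ =>
      (isCompact_shadow v (isCompact_reverseGauss hK (hω i))).measurableSet.nullMeasurableSet

/-- A compact set has a finite measurable partition into pieces of small diameter. -/
theorem exists_partition_subset_ball {X : Type*} [PseudoMetricSpace X] [MeasurableSpace X]
    [OpensMeasurableSpace X] {s : Set X} (hs : IsCompact s) (hsm : MeasurableSet s) {e : ℝ}
    (he : 0 < e) : ∃ (N : ℕ) (p : Fin N → X) (B : Fin N → Set X), (∀ i, p i ∈ s) ∧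
      (∀ i, MeasurableSet (B i)) ∧ (∀ i, B i ⊆ s ∩ ball (p i) e) ∧
      Pairwise (Function.onFun Disjoint B) ∧ s ⊆ ⋃ i, B i := by
  obtain ⟨t, hts, htf, hst⟩ := hs.finite_cover_balls he
  obtain ⟨N, p, hp⟩ := htf.fin_param
  have hb : ∀ i, MeasurableSet (s ∩ ball (p i) e) := fun i => hsm.inter measurableSet_ball
  refine ⟨N, p, disjointed fun i => s ∩ ball (p i) e, fun i => hts ?_, fun i => ?_,
    fun i => disjointed_subset _ _, disjoint_disjointed _, ?_⟩
  · rw [← hp.2]; exact ⟨i, rfl⟩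
  · exact disjointedRec (fun _ _ ht => MeasurableSet.diff ht <| hb _) (hb i)
  · rw [iUnion_disjointed]
    intro x hx
    obtain ⟨y, hy, hxy⟩ := Set.mem_iUnion₂.1 (hst hx)
    rw [← hp.2] at hy
    obtain ⟨i, rfl⟩ := hy
    exact Set.mem_iUnion.2 ⟨i, hx, hxy⟩

theorem lintegral_inner_le_area_shadow_aux {m : ℕ} {K : Set (En (m + 1))} (hK : IsCompact K)
    {v : En (m + 1)} (hv : ‖v‖ = 1) {μ : Measure (Sph (m + 1))} [IsFiniteMeasure μ]
    (hμ : ∀ ω, MeasurableSet ω → μ ω = μHE[m] (reverseGauss K ω))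
    {c η : ℝ} (hc : 0 < c) (hc1 : c < 1) (hη : 0 < η) :
    ENNReal.ofReal (c ^ m) * ∫⁻ u in {u : Sph (m + 1) | η ≤ ⟪v, (u : En (m + 1))⟫_ℝ},
      ENNReal.ofReal ⟪v, (u : En (m + 1))⟫_ℝ ∂μ ≤
      ENNReal.ofReal (2 - c) * μHE[m] (shadow v K) := by
  have hs : IsClosed {u : Sph (m + 1) | η ≤ ⟪v, (u : En (m + 1))⟫_ℝ} :=
    isClosed_le (by fun_prop) (by fun_prop)
  obtain ⟨N, p, B, hp, hBm, hB, hd, hcov⟩ := exists_partition_subset_ball hs.isCompact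
    hs.measurableSet (e := (1 - c) * η) (by nlinarith)
  have hsum : ∑ i, ENNReal.ofReal (c ^ m) * (ENNReal.ofReal ⟪v, (p i : En (m + 1))⟫_ℝ * μ (B i)) ≤
      μHE[m] (shadow v K) := by
    refine ENNReal.le_of_forall_pos_le_add fun ε hε _ => ?_
    have hε' : (ε : ℝ≥0∞) / (N + 1) ≠ 0 := by
      refine (ENNReal.div_pos (by exact_mod_cast hε.ne') ?_).ne'
      exact ENNReal.add_ne_top.2 ⟨ENNReal.natCast_ne_top _, ENNReal.one_ne_top⟩
    choose ω hω hωc hωμ using fun i =>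
      (hBm i).exists_isCompact_lt_add (measure_ne_top μ _) hε'
    have h := sum_area_le_area_shadow hK hv hμ hc hc1 hη p hp ω hωc
      (fun i => (hω i).trans ((hB i).trans Set.inter_subset_right))
      (fun i j hij => (hd hij).mono (hω i) (hω j))
    have hone : ∀ i, ENNReal.ofReal (c ^ m) * ENNReal.ofReal ⟪v, (p i : En (m + 1))⟫_ℝ ≤ 1 := by
      intro i
      rw [← ENNReal.ofReal_mul (by positivity), ← ENNReal.ofReal_one]
      refine ENNReal.ofReal_le_ofReal (mul_le_one₀ (pow_le_one₀ hc.le hc1.le)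
        (hη.le.trans (hp i)) ?_)
      refine (real_inner_le_norm _ _).trans ?_
      rw [hv, one_mul, mem_sphere_zero_iff_norm.1 (p i).2]
    calc _ ≤ ∑ i, (ENNReal.ofReal (c ^ m) *
          (ENNReal.ofReal ⟪v, (p i : En (m + 1))⟫_ℝ * μ (ω i)) + (ε : ℝ≥0∞) / (N + 1)) := by
          refine Finset.sum_le_sum fun i _ => ?_
          calc _ ≤ ENNReal.ofReal (c ^ m) * (ENNReal.ofReal ⟪v, (p i : En (m + 1))⟫_ℝ *
                (μ (ω i) + (ε : ℝ≥0∞) / (N + 1))) := by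
                gcongr; exact (hωμ i).le
            _ = ENNReal.ofReal (c ^ m) * (ENNReal.ofReal ⟪v, (p i : En (m + 1))⟫_ℝ * μ (ω i)) +
                (ENNReal.ofReal (c ^ m) * ENNReal.ofReal ⟪v, (p i : En (m + 1))⟫_ℝ) *
                ((ε : ℝ≥0∞) / (N + 1)) := by ring
            _ ≤ _ := by
                gcongr
                exact mul_le_of_le_one_left bot_le (hone i)
      _ ≤ _ := by
          rw [Finset.sum_add_distrib, Finset.sum_const, Finset.card_univ, Fintype.card_fin,
            nsmul_eq_mul]
          refine add_le_add h ?_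
          calc (N : ℝ≥0∞) * ((ε : ℝ≥0∞) / (N + 1)) ≤ (N + 1) * ((ε : ℝ≥0∞) / (N + 1)) := by
                gcongr; exact le_self_add
            _ ≤ _ := ENNReal.mul_div_le
  calc _ ≤ ENNReal.ofReal (c ^ m) * ∑ i, ENNReal.ofReal (2 - c) *
        (ENNReal.ofReal ⟪v, (p i : En (m + 1))⟫_ℝ * μ (B i)) := by
        gcongr
        refine (lintegral_mono_set hcov).trans ?_
        refine (lintegral_iUnion_le _ _).trans ?_
        rw [tsum_fintype]
        refine Finset.sum_le_sum fun i _ => ?_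
        rw [← mul_assoc, ← ENNReal.ofReal_mul (by linarith), ← setLIntegral_const]
        refine setLIntegral_mono' (hBm i) fun u hu => ENNReal.ofReal_le_ofReal ?_
        have h1 : ‖(u : En (m + 1)) - p i‖ < (1 - c) * η := by
          rw [← dist_eq_norm]; exact (hB i hu).2
        have h2 := real_inner_le_norm v ((u : En (m + 1)) - p i)
        rw [hv, one_mul, inner_sub_right] at h2
        have h3 : (1 - c) * η ≤ (1 - c) * ⟪v, (p i : En (m + 1))⟫_ℝ :=
          mul_le_mul_of_nonneg_left (hp i) (by linarith)
        linarith
    _ = ENNReal.ofReal (2 - c) * ∑ i, ENNReal.ofReal (c ^ m) *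
        (ENNReal.ofReal ⟪v, (p i : En (m + 1))⟫_ℝ * μ (B i)) := by
        rw [Finset.mul_sum, Finset.mul_sum]
        exact Finset.sum_congr rfl fun i _ => by ring
    _ ≤ _ := by gcongr

/-- The projection of the surface area measure is bounded by the area of the shadow. -/
theorem lintegral_inner_le_area_shadow {m : ℕ} {K : Set (En (m + 1))} (hK : IsCompact K)
    {v : En (m + 1)} (hv : ‖v‖ = 1) {μ : Measure (Sph (m + 1))} [IsFiniteMeasure μ]
    (hμ : ∀ ω, MeasurableSet ω → μ ω = μHE[m] (reverseGauss K ω)) :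
    ∫⁻ u, ENNReal.ofReal ⟪v, (u : En (m + 1))⟫_ℝ ∂μ ≤ μHE[m] (shadow v K) := by
  have h1 : ∀ η : ℝ, 0 < η → ∫⁻ u in {u : Sph (m + 1) | η ≤ ⟪v, (u : En (m + 1))⟫_ℝ},
      ENNReal.ofReal ⟪v, (u : En (m + 1))⟫_ℝ ∂μ ≤ μHE[m] (shadow v K) := by
    intro η hη
    have l1 : Tendsto (fun c : ℝ => ENNReal.ofReal (c ^ m) *
        ∫⁻ u in {u : Sph (m + 1) | η ≤ ⟪v, (u : En (m + 1))⟫_ℝ},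
          ENNReal.ofReal ⟪v, (u : En (m + 1))⟫_ℝ ∂μ) (𝓝[<] 1) (𝓝 (ENNReal.ofReal (1 ^ m) *
        ∫⁻ u in {u : Sph (m + 1) | η ≤ ⟪v, (u : En (m + 1))⟫_ℝ},
          ENNReal.ofReal ⟪v, (u : En (m + 1))⟫_ℝ ∂μ)) := by
      refine ENNReal.Tendsto.mul_const ?_ (Or.inl (by simp))
      have hc : Continuous fun c : ℝ => ENNReal.ofReal (c ^ m) :=
        ENNReal.continuous_ofReal.comp (by fun_prop)
      exact (hc.tendsto 1).mono_left (nhdsWithin_le_nhds (s := Set.Iio 1))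
    have l2 : Tendsto (fun c : ℝ => ENNReal.ofReal (2 - c) * μHE[m] (shadow v K)) (𝓝[<] 1)
        (𝓝 (ENNReal.ofReal (2 - 1) * μHE[m] (shadow v K))) := by
      refine ENNReal.Tendsto.mul_const ?_ (Or.inl (by norm_num))
      have hc : Continuous fun c : ℝ => ENNReal.ofReal (2 - c) :=
        ENNReal.continuous_ofReal.comp (by fun_prop)
      exact (hc.tendsto 1).mono_left (nhdsWithin_le_nhds (s := Set.Iio 1))
    have h := le_of_tendsto_of_tendsto l1 l2 (by
      filter_upwards [Ioo_mem_nhdsLT (show (0 : ℝ) < 1 by norm_num)] with c hc using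
        lintegral_inner_le_area_shadow_aux hK hv hμ hc.1 hc.2 hη)
    norm_num at h
    exact h
  have h2 : ∀ η : ℝ, 0 < η → ∫⁻ u, ENNReal.ofReal ⟪v, (u : En (m + 1))⟫_ℝ ∂μ ≤
      μHE[m] (shadow v K) + ENNReal.ofReal η * μ Set.univ := by
    intro η hη
    have hs : MeasurableSet {u : Sph (m + 1) | η ≤ ⟪v, (u : En (m + 1))⟫_ℝ} :=
      (isClosed_le (by fun_prop) (by fun_prop)).measurableSet
    rw [← lintegral_add_compl _ hs]
    refine add_le_add (h1 η hη) ?_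
    calc _ ≤ ∫⁻ u in {u : Sph (m + 1) | η ≤ ⟪v, (u : En (m + 1))⟫_ℝ}ᶜ, ENNReal.ofReal η ∂μ :=
          setLIntegral_mono' hs.compl fun u hu =>
            ENNReal.ofReal_le_ofReal (not_le.1 (by exact hu)).le
      _ ≤ _ := by
          rw [setLIntegral_const]
          gcongr
          exact Set.subset_univ _
  have l3 : Tendsto (fun η : ℝ => μHE[m] (shadow v K) + ENNReal.ofReal η * μ Set.univ) (𝓝[>] 0)
      (𝓝 (μHE[m] (shadow v K) + ENNReal.ofReal 0 * μ Set.univ)) := by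
    refine Tendsto.const_add _ (ENNReal.Tendsto.mul_const ?_ (Or.inr (measure_ne_top _ _)))
    exact (ENNReal.continuous_ofReal.tendsto 0).mono_left nhdsWithin_le_nhds
  have h := ge_of_tendsto l3 (by filter_upwards [self_mem_nhdsWithin] with η hη using h2 η hη)
  simpa using h

theorem lintegral_inner_sq_le_area_shadow {m : ℕ} {K : Set (En (m + 1))} (hK : IsCompact K)
    {v : En (m + 1)} (hv : ‖v‖ = 1) {μ : Measure (Sph (m + 1))} [IsFiniteMeasure μ]
    (hμ : ∀ ω, MeasurableSet ω → μ ω = μHE[m] (reverseGauss K ω)) :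
    ∫⁻ u, ENNReal.ofReal (⟪v, (u : En (m + 1))⟫_ℝ ^ 2) ∂μ ≤ 2 * μHE[m] (shadow v K) := by
  have hneg : shadow (-v) K = shadow v K := by
    simp only [shadow, inner_neg_right, neg_smul, smul_neg, neg_neg]
  have h1 := lintegral_inner_le_area_shadow hK hv hμ
  have h2 := lintegral_inner_le_area_shadow hK (v := -v) (by rwa [norm_neg]) hμ
  rw [hneg] at h2
  rw [two_mul]
  refine le_trans ?_ (add_le_add h1 h2)
  rw [← lintegral_add_left (by
    exact (ENNReal.continuous_ofReal.comp (by fun_prop)).measurable)]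
  refine lintegral_mono fun u => ?_
  have h3 : |⟪v, (u : En (m + 1))⟫_ℝ| ≤ 1 := by
    refine (abs_real_inner_le_norm _ _).trans ?_
    rw [hv, one_mul, mem_sphere_zero_iff_norm.1 u.2]
  rw [inner_neg_left]
  have h4 : ⟪v, (u : En (m + 1))⟫_ℝ ^ 2 ≤ |⟪v, (u : En (m + 1))⟫_ℝ| := by
    rw [← sq_abs]
    nlinarith [abs_nonneg ⟪v, (u : En (m + 1))⟫_ℝ]
  refine (ENNReal.ofReal_le_ofReal h4).trans ?_
  rcases abs_cases ⟪v, (u : En (m + 1))⟫_ℝ with ⟨h, _⟩ | ⟨h, _⟩ <;> rw [h]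
  · exact le_self_add
  · exact le_add_self

/-- Comparison of volumes by comparing the intersections with all lines of a given direction. -/
theorem volume_le_of_lines {m : ℕ} {v : En (m + 1)} (hv : ‖v‖ = 1) {s t : Set (En (m + 1))}
    (hs : MeasurableSet s) (ht : MeasurableSet t)
    (h : ∀ z, volume {r : ℝ | z + r • v ∈ s} ≤ volume {r : ℝ | z + r • v ∈ t}) :
    volume s ≤ volume t := by
  have hv0 : v ≠ 0 := by rintro rfl; simp at hv
  set S : AffineSubspace ℝ (En (m + 1)) := AffineSubspace.mk' 0 (ℝ ∙ v)ᗮ with hS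
  have hdir : S.directionᗮ = ℝ ∙ v := by
    rw [hS, AffineSubspace.direction_mk', Submodule.orthogonal_orthogonal]
  have hr : Module.finrank ℝ (En (m + 1)) = m + 1 := by simp
  have hr1 : Module.finrank ℝ (S.directionᗮ) = 1 := by
    rw [hdir]; exact finrank_span_singleton hv0
  have hiso : ∀ z : En (m + 1), Isometry fun r : ℝ => z + r • v := by
    intro z
    refine Isometry.of_dist_eq fun a b => ?_
    rw [dist_add_left, dist_eq_norm, ← sub_smul, norm_smul, hv, mul_one, dist_eq_norm]
  have hline : ∀ (z : En (m + 1)) (A : Set (En (m + 1))),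
      μHE[1] (A ∩ (AffineSubspace.mk' z (ℝ ∙ v) : AffineSubspace ℝ (En (m + 1)))) =
        volume {r : ℝ | z + r • v ∈ A} := by
    intro z A
    have e : (A ∩ (AffineSubspace.mk' z (ℝ ∙ v) : AffineSubspace ℝ (En (m + 1))) :
        Set (En (m + 1))) = (fun r : ℝ => z + r • v) '' {r : ℝ | z + r • v ∈ A} := by
      ext y
      simp only [Set.mem_inter_iff, SetLike.mem_coe, AffineSubspace.mem_mk',
        Submodule.mem_span_singleton, Set.mem_image, Set.mem_ofPred_eq, vsub_eq_sub]
      constructor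
      · rintro ⟨hy, r, hr⟩
        have : z + r • v = y := by rw [hr]; abel
        exact ⟨r, this ▸ hy, this⟩
      · rintro ⟨r, hr, rfl⟩
        exact ⟨hr, r, by abel⟩
    rw [e, (hiso z).euclideanHausdorffMeasure_image]
    have := InnerProductSpace.euclideanHausdorffMeasure_eq_volume (V := ℝ)
    rw [Module.finrank_self] at this
    rw [this]
  have h1 := AffineSubspace.euclideanHausdorffMeasure_eq_lintegral S hs
  have h2 := AffineSubspace.euclideanHausdorffMeasure_eq_lintegral S ht
  rw [hr, EuclideanSpace.euclideanHausdorffMeasure_eq_volume, hr1] at h1 h2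
  rw [h1, h2]
  refine lintegral_mono fun z => ?_
  simp only [hdir]
  rw [hline, hline]
  exact h z

/-- The volume of a convex body containing the segment `[0, L v]` is at least the volume of the
cone over its shadow with height `L`. -/
theorem area_shadow_le_volume {m : ℕ} {K : Set (En (m + 1))} (hconv : Convex ℝ K)
    (hK : IsCompact K) {v : En (m + 1)} (hv : ‖v‖ = 1) {L : ℝ} (hL : 0 < L) (h0 : 0 ∈ K)
    (hLv : L • v ∈ K) :
    ENNReal.ofReal (L / (m + 1)) * μHE[m] (shadow v K) ≤ volume K := by
  have hvv : ⟪v, v⟫_ℝ = 1 := by rw [real_inner_self_eq_norm_sq, hv, one_pow]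
  set D : Set (En (m + 1)) := (fun q => q + L • v) '' shadow v K with hD
  have hDc : IsCompact D := (isCompact_shadow v hK).image (by fun_prop)
  have hDarea : μHE[m] D = μHE[m] (shadow v K) :=
    (isometry_add_right (L • v)).euclideanHausdorffMeasure_image _
  have hDv : ∀ y ∈ D, ⟪y, v⟫_ℝ = L := by
    rintro _ ⟨_, ⟨y, _, rfl⟩, rfl⟩
    simp only [inner_add_left, inner_sub_left, inner_smul_left, hvv, conj_trivial, mul_one,
      sub_self, zero_add]
  have hvol := volume_cone hv hL hDc.measurableSet hDv
  rw [← hDarea, ← hvol]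
  have hcm : MeasurableSet {z | ∃ t ∈ Set.Ioc (0 : ℝ) 1, ∃ q ∈ D, z = t • q} :=
    measurableSet_cone hL hDc.measurableSet hDv
  refine volume_le_of_lines hv hcm hK.measurableSet fun z => ?_
  set C := {r : ℝ | z + r • v ∈ {z | ∃ t ∈ Set.Ioc (0 : ℝ) 1, ∃ q ∈ D, z = t • q}} with hC
  -- the fibre over `z` of the convex body contains a segment of the right length
  have hseg : ∀ r ∈ C, r + ⟪z, v⟫_ℝ ∈ Set.Ioc 0 L ∧
      ENNReal.ofReal (L - (r + ⟪z, v⟫_ℝ)) ≤ volume {r : ℝ | z + r • v ∈ K} := by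
    rintro r ⟨t, ht, _, ⟨_, ⟨y, hy, rfl⟩, rfl⟩, h⟩
    have e1 : r + ⟪z, v⟫_ℝ = t * L := by
      have := congrArg (fun w => ⟪w, v⟫_ℝ) h
      simp only [inner_add_left, inner_sub_left, inner_smul_left, hvv, conj_trivial] at this
      linarith
    refine ⟨by rw [e1]; exact ⟨by nlinarith [ht.1], by nlinarith [ht.2]⟩, ?_⟩
    have hsub : Set.Icc (t * ⟪y, v⟫_ℝ - ⟪z, v⟫_ℝ) (t * ⟪y, v⟫_ℝ - ⟪z, v⟫_ℝ + (L - t * L)) ⊆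
        {r : ℝ | z + r • v ∈ K} := by
      rintro a ⟨ha1, ha2⟩
      have e2 : z + a • v = t • y + (a + ⟪z, v⟫_ℝ - t * ⟪y, v⟫_ℝ) • v := by
        have : z = t • (y - ⟪y, v⟫_ℝ • v + L • v) - r • v := by rw [← h]; abel
        have hr : r = t * L - ⟪z, v⟫_ℝ := by linarith
        rw [hr] at this
        nth_rewrite 1 [this]
        module
      set b := a + ⟪z, v⟫_ℝ - t * ⟪y, v⟫_ℝ with hb
      rw [Set.mem_ofPred_eq, e2]
      have hw : (b / L) • (L • v) = b • v := by
        rw [smul_smul, div_mul_cancel₀ _ hL.ne']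
      have hb0 : 0 ≤ b := by linarith
      have hb1 : b / L ≤ 1 - t := by rw [div_le_iff₀ hL]; linarith
      have := hconv.sum_mem (t := Finset.univ) (w := ![t, b / L, 1 - t - b / L])
        (z := ![y, L • v, 0]) (by
          intro i _
          fin_cases i
          · exact ht.1.le
          · exact div_nonneg hb0 hL.le
          · simp; linarith) (by simp [Fin.sum_univ_three]) (by
          intro i _
          fin_cases i
          exacts [hy, hLv, h0])
      simpa [Fin.sum_univ_three, smul_smul, div_mul_cancel₀ _ hL.ne'] using this
    refine le_trans ?_ (measure_mono hsub)
    rw [Real.volume_Icc, e1]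
    exact ENNReal.ofReal_le_ofReal (by linarith)
  rcases C.eq_empty_or_nonempty with hCe | hCn
  · rw [hCe, measure_empty]; exact bot_le
  have hbdd : BddBelow C := ⟨-⟪z, v⟫_ℝ, fun r hr => by linarith [(hseg r hr).1.1]⟩
  refine ENNReal.le_of_forall_pos_le_add fun ε hε _ => ?_
  obtain ⟨r, hr, hrε⟩ := exists_lt_of_csInf_lt hCn (lt_add_of_pos_right (sInf C)
    (NNReal.coe_pos.2 hε))
  have hsub : C ⊆ Set.Icc (sInf C) (L - ⟪z, v⟫_ℝ) :=
    fun a ha => ⟨csInf_le hbdd ha, by linarith [(hseg a ha).1.2]⟩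
  refine (measure_mono hsub).trans ?_
  rw [Real.volume_Icc]
  calc _ ≤ ENNReal.ofReal ((L - (r + ⟪z, v⟫_ℝ)) + ε) := ENNReal.ofReal_le_ofReal (by linarith)
    _ ≤ ENNReal.ofReal (L - (r + ⟪z, v⟫_ℝ)) + ENNReal.ofReal ε := ENNReal.ofReal_add_le
    _ ≤ _ := by
      rw [ENNReal.ofReal_coe_nnreal]
      gcongr
      exact (hseg r hr).2

/-- The smallest eigenvalue of a symmetric matrix bounds its quadratic form from below. -/
theorem mul_dotProduct_self_le {n : ℕ} {M : Matrix (Fin n) (Fin n) ℝ} (hM : M.IsHermitian)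
    {l : ℝ} (hl : ∀ l', IsEigenvalue M l' → l ≤ l') (v : Fin n → ℝ) :
    l * (v ⬝ᵥ v) ≤ v ⬝ᵥ M.mulVec v := by
  have hB : (M - l • (1 : Matrix (Fin n) (Fin n) ℝ)).IsHermitian :=
    hM.sub (Matrix.isHermitian_one.smul (IsSelfAdjoint.all l))
  have hmul : ∀ w, (M - l • (1 : Matrix (Fin n) (Fin n) ℝ)).mulVec w = M.mulVec w - l • w := by
    intro w
    rw [Matrix.sub_mulVec, Matrix.smul_mulVec, Matrix.one_mulVec]
  have hpos : (M - l • (1 : Matrix (Fin n) (Fin n) ℝ)).PosSemidef := by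
    rw [hB.posSemidef_iff_eigenvalues_nonneg]
    intro j
    have h := hB.mulVec_eigenvectorBasis j
    rw [hmul, sub_eq_iff_eq_add, ← add_smul] at h
    have h2 := hl _ ⟨_, fun h0 => ?_, h⟩
    · simpa using h2
    · have h3 := hB.eigenvectorBasis.orthonormal.ne_zero j
      exact h3 (by ext i; exact congrFun h0 i)
  have h := hpos.dotProduct_mulVec_nonneg v
  rw [star_trivial, hmul, dotProduct_sub, dotProduct_smul, smul_eq_mul] at h
  linarith

theorem isHermitian_rank2TensorMatrix {n : ℕ} (μ : Measure (Sph n)) :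
    (rank2TensorMatrix μ).IsHermitian := by
  ext i j
  simp only [rank2TensorMatrix, Matrix.conjTranspose_apply, Matrix.of_apply, star_trivial]
  congr 2
  ext u
  rw [mul_comm]

theorem isFiniteMeasure_of_eigenvalue_pos {n : ℕ} {μ : Measure (Sph n)} {l : ℝ} (hl0 : 0 < l)
    (hl : ∀ l', IsEigenvalue (rank2TensorMatrix μ) l' → l ≤ l') : IsFiniteMeasure μ := by
  have hi : ∀ i, Integrable (fun u : Sph n => (u : En n) i * (u : En n) i) μ := by
    intro i
    by_contra hcon
    have h := mul_dotProduct_self_le (isHermitian_rank2TensorMatrix μ) hl (Pi.single i 1)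
    simp [rank2TensorMatrix, integral_undef hcon] at h
    linarith
  have h1 : Integrable (fun u : Sph n => ∑ i, (u : En n) i * (u : En n) i) μ :=
    integrable_finsetSum _ fun i _ => hi i
  have h2 : (fun u : Sph n => ∑ i, (u : En n) i * (u : En n) i) = fun _ => (1 : ℝ) := by
    ext u
    have := EuclideanSpace.real_norm_sq_eq (u : En n)
    rw [mem_sphere_zero_iff_norm.1 u.2] at this
    simp only [← sq]
    linarith
  rw [h2, integrable_const_iff] at h1
  exact h1.resolve_left one_ne_zero

theorem mul_le_integral_inner_sq {n : ℕ} {μ : Measure (Sph n)} [IsFiniteMeasure μ] {l : ℝ}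
    (hl : ∀ l', IsEigenvalue (rank2TensorMatrix μ) l' → l ≤ l') {v : En n} (hv : ‖v‖ = 1) :
    8 * π * l ≤ ∫ u, ⟪v, (u : En n)⟫_ℝ ^ 2 ∂μ := by
  have h := mul_dotProduct_self_le (isHermitian_rank2TensorMatrix μ) hl v.ofLp
  have h1 : v.ofLp ⬝ᵥ v.ofLp = 1 := by
    have := EuclideanSpace.real_norm_sq_eq v
    rw [hv, one_pow] at this
    rw [this]
    exact Finset.sum_congr rfl fun i _ => (sq _).symm
  have hint : ∀ i j, Integrable (fun u : Sph n => (u : En n) i * (u : En n) j) μ := by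
    intro i j
    refine Integrable.of_bound (C := 1) (by
      exact (Continuous.aestronglyMeasurable (by fun_prop))) (ae_of_all _ fun u => ?_)
    have hu : ∀ i, ‖(u : En n) i‖ ≤ 1 := fun i =>
      (PiLp.norm_apply_le _ i).trans (mem_sphere_zero_iff_norm.1 u.2).le
    rw [norm_mul]
    exact mul_le_one₀ (hu i) (norm_nonneg _) (hu j)
  have h2 : ∫ u, ⟪v, (u : En n)⟫_ℝ ^ 2 ∂μ =
      ∑ i, ∑ j, v i * v j * ∫ u, (u : En n) i * (u : En n) j ∂μ := by
    have : ∀ u : Sph n, ⟪v, (u : En n)⟫_ℝ ^ 2 =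
        ∑ i, ∑ j, v i * v j * ((u : En n) i * (u : En n) j) := by
      intro u
      rw [PiLp.inner_apply, sq, Finset.sum_mul_sum]
      refine Finset.sum_congr rfl fun i _ => Finset.sum_congr rfl fun j _ => ?_
      simp
      ring
    simp_rw [this]
    rw [integral_finsetSum _ fun i _ => integrable_finsetSum _ fun j _ => (hint i j).const_mul _]
    refine Finset.sum_congr rfl fun i _ => ?_
    rw [integral_finsetSum _ fun j _ => (hint i j).const_mul _]
    exact Finset.sum_congr rfl fun j _ => integral_const_mul _ _
  have h3 : v.ofLp ⬝ᵥ (rank2TensorMatrix μ).mulVec v.ofLp =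
      1 / (8 * π) * ∫ u, ⟪v, (u : En n)⟫_ℝ ^ 2 ∂μ := by
    rw [h2]
    simp only [dotProduct, Matrix.mulVec, rank2TensorMatrix, Matrix.of_apply, Finset.mul_sum]
    exact Finset.sum_congr rfl fun i _ => Finset.sum_congr rfl fun j _ => by ring
  rw [h1, h3, mul_one, one_div_mul_eq_div, le_div_iff₀ (by positivity)] at h
  linarith

theorem reverseGauss_univ {n : ℕ} {K : Set (En n)} (hconv : Convex ℝ K)
    (hint : (interior K).Nonempty) : reverseGauss K Set.univ = frontier K := by
  refine Set.Subset.antisymm (fun x hx => hx.1) fun x hx => ⟨hx, ?_⟩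
  obtain ⟨a, ha, hai⟩ := exists_support hconv hint hx
  obtain ⟨y, hy⟩ := hint
  have ha0 : 0 < ‖a‖ := norm_pos_iff.2 (by rintro rfl; simpa using hai y hy)
  refine ⟨⟨‖a‖⁻¹ • a, by simp [norm_smul, ha0.ne']⟩, trivial, fun z hz => ?_⟩
  rw [inner_smul_right, inner_sub_left]
  exact mul_nonpos_of_nonneg_of_nonpos (by positivity) (by linarith [ha z hz])

theorem zero_mem_of_centroid {n : ℕ} {K : Set (En n)} (hconv : Convex ℝ K) (hK : IsCompact K)
    (hint : (interior K).Nonempty) (hcent : ∫ x in K, x = 0) : (0 : En n) ∈ K := by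
  have h0 : volume K ≠ 0 := (Measure.measure_pos_of_nonempty_interior _ hint).ne'
  have h := hconv.set_average_mem (μ := volume) (t := K) (f := id) hK.isClosed h0
    hK.measure_ne_top (ae_restrict_mem hK.measurableSet)
    (continuous_id.continuousOn.integrableOn_compact hK)
  rw [setAverage_eq] at h
  simpa [hcent] using h

theorem volume_closedBall_le_area_sphere {m : ℕ} :
    ENNReal.ofReal (m + 1) * volume (closedBall (0 : En (m + 1)) 1) ≤
      μHE[m] (sphere (0 : En (m + 1)) 1) := by
  have h := isoperimetric (convex_closedBall (0 : En (m + 1)) 1) (isCompact_closedBall _ _)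
    (by rw [interior_closedBall _ one_ne_zero]; exact ⟨0, by simp⟩) one_pos (by simp)
  rwa [frontier_closedBall _ one_ne_zero, one_pow, mul_one] at h

theorem sphLebesgue_univ (m : ℕ) :
    sphLebesgue (m + 1) Set.univ = μH[m] (sphere (0 : En (m + 1)) 1) := by
  have hm : ((m + 1 : ℕ) : ℝ) - 1 = m := by push_cast; ring
  rw [sphLebesgue, hm, ← isometry_subtype_coe.hausdorffMeasure_image (Or.inl (by positivity)),
    Set.image_univ, Subtype.range_coe]

/-- The bound on a point of a convex body, with surface areas normalized in an arbitrary way. -/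
theorem norm_mul_eigenvalue_le {m : ℕ} (hm : m ≠ 0) {K : Set (En (m + 1))} (hconv : Convex ℝ K)
    (hK : IsCompact K) (hint : (interior K).Nonempty) (h0 : 0 ∈ K)
    {μ : Measure (Sph (m + 1))} [IsFiniteMeasure μ]
    (hμ : ∀ ω, MeasurableSet ω → μ ω = μH[m] (reverseGauss K ω))
    {l : ℝ} (hl : ∀ l', IsEigenvalue (rank2TensorMatrix μ) l' → l ≤ l')
    {x : En (m + 1)} (hx : x ∈ K) :
    ‖x‖ * (4 * π * l) ≤ (μ Set.univ).toReal *
      ((μ Set.univ).toReal / omegaN (m + 1)) ^ (1 / (m : ℝ)) := by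
  obtain ⟨k, hk0, hk⟩ : ∃ k : ℝ≥0, k ≠ 0 ∧
      (μHE[m] : Measure (En (m + 1))) = k • (μH[m] : Measure (En (m + 1))) :=
    ⟨_, Measure.addHaarScalarFactor_volume_hausdorffMeasure_ne_zero m,
      Measure.euclideanHausdorffMeasure_def m⟩
  have hkap : ∀ A, μHE[m] A = k * μH[m] A := fun A => by rw [hk]; rfl
  have hkpos : 0 < (k : ℝ) := NNReal.coe_pos.2 (pos_iff_ne_zero.2 hk0)
  set κ := (volume (closedBall (0 : En (m + 1)) 1)).toReal with hκ
  have hκpos : 0 < κ := ENNReal.toReal_pos (volume_unitBall_ne_zero _) (volume_unitBall_ne_top _)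
  have hκe : volume (closedBall (0 : En (m + 1)) 1) = ENNReal.ofReal κ :=
    (ENNReal.ofReal_toReal (volume_unitBall_ne_top _)).symm
  set S := (μ Set.univ).toReal with hS
  have hSe : μHE[m] (frontier K) = ENNReal.ofReal (k * S) := by
    rw [hkap, ← reverseGauss_univ hconv hint, ← hμ _ MeasurableSet.univ,
      ENNReal.ofReal_mul hkpos.le, hS, ENNReal.ofReal_toReal (measure_ne_top _ _),
      ENNReal.ofReal_coe_nnreal]
  have hS0 : 0 ≤ S := ENNReal.toReal_nonneg
  -- the surface area of the sphere
  have hω : (k : ℝ) * omegaN (m + 1) = (m + 1) * κ := by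
    have h := le_antisymm (sphere_area_le (m := m)) volume_closedBall_le_area_sphere
    rw [hkap, ← sphLebesgue_univ] at h
    have := congrArg ENNReal.toReal h
    rwa [ENNReal.toReal_mul, ENNReal.toReal_mul, ENNReal.toReal_ofReal (by positivity)] at this
  have hωpos : 0 < omegaN (m + 1) := by
    have : 0 < (k : ℝ) * omegaN (m + 1) := by rw [hω]; positivity
    exact pos_of_mul_pos_right this hkpos.le
  -- the radius of the ball with the same volume
  obtain ⟨r, hr0, hV⟩ := exists_volume_eq_ball hK.measure_ne_top
  have hrpos : 0 < r := by
    refine hr0.lt_of_ne ?_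
    rintro rfl
    have : volume K = 0 := by simpa using hV
    exact (Measure.measure_pos_of_nonempty_interior volume hint).ne' this
  have hiso : (m + 1) * r ^ m * κ ≤ k * S := by
    have h := isoperimetric hconv hK hint hrpos hV
    rw [hSe, hκe, ← ENNReal.ofReal_mul (by positivity)] at h
    exact (ENNReal.ofReal_le_ofReal_iff (by positivity)).1 h
  have hrS : r ≤ (S / omegaN (m + 1)) ^ (1 / (m : ℝ)) := by
    have h1 : r ^ m ≤ S / omegaN (m + 1) := by
      rw [le_div_iff₀ hωpos]
      refine le_of_mul_le_mul_left ?_ hkpos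
      calc (k : ℝ) * (r ^ m * omegaN (m + 1)) = r ^ m * (k * omegaN (m + 1)) := by ring
        _ = (m + 1) * r ^ m * κ := by rw [hω]; ring
        _ ≤ _ := hiso
    calc r = (r ^ m) ^ (1 / (m : ℝ)) := by
          rw [one_div, Real.pow_rpow_inv_natCast hr0 hm]
      _ ≤ _ := Real.rpow_le_rpow (by positivity) h1 (by positivity)
  have hfin : ‖x‖ * (4 * π * l) ≤ S * r := by
    rcases eq_or_ne x 0 with rfl | hx0
    · rw [norm_zero, zero_mul]; positivity
    have hL : 0 < ‖x‖ := norm_pos_iff.2 hx0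
    set v := ‖x‖⁻¹ • x with hvdef
    have hv : ‖v‖ = 1 := by simp [hvdef, norm_smul, hL.ne']
    have hvx : ‖x‖ • v = x := by rw [hvdef, smul_smul, mul_inv_cancel₀ hL.ne', one_smul]
    have hcone := area_shadow_le_volume hconv hK hv hL h0 (hvx.symm ▸ hx)
    have hP : μHE[m] (shadow v K) ≠ ∞ := by
      intro h
      rw [h, ENNReal.mul_top (by rw [ENNReal.ofReal_ne_zero_iff]; positivity)] at hcone
      exact hK.measure_ne_top (top_le_iff.1 hcone)
    set p := (μHE[m] (shadow v K)).toReal with hp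
    have hpe : μHE[m] (shadow v K) = ENNReal.ofReal p := (ENNReal.ofReal_toReal hP).symm
    have h1 : ‖x‖ * p ≤ (m + 1) * (r ^ (m + 1) * κ) := by
      rw [hpe, hV, hκe, ← ENNReal.ofReal_mul (by positivity), ← ENNReal.ofReal_mul (by positivity),
        ENNReal.ofReal_le_ofReal_iff (by positivity), div_mul_eq_mul_div,
        div_le_iff₀ (by positivity)] at hcone
      linarith
    have h2 : k * ∫ u, ⟪v, (u : En (m + 1))⟫_ℝ ^ 2 ∂μ ≤ 2 * p := by
      have h := lintegral_inner_sq_le_area_shadow hK hv (μ := k • μ) (fun ω hω => by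
        rw [hkap, ← hμ ω hω]; rfl)
      rw [hpe] at h
      have h3 : ∀ u : Sph (m + 1), 0 ≤ ⟪v, (u : En (m + 1))⟫_ℝ ^ 2 := fun u => sq_nonneg _
      have hc : Continuous fun u : Sph (m + 1) => ⟪v, (u : En (m + 1))⟫_ℝ ^ 2 := by fun_prop
      have h4 : ∫ u, ⟪v, (u : En (m + 1))⟫_ℝ ^ 2 ∂(k • μ) ≤ 2 * p := by
        rw [integral_eq_lintegral_of_nonneg_ae (ae_of_all _ h3) hc.aestronglyMeasurable]
        have h5 := ENNReal.toReal_mono (by finiteness) h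
        rwa [ENNReal.toReal_mul, ENNReal.toReal_ofReal ENNReal.toReal_nonneg,
          ENNReal.toReal_ofNat] at h5
      rwa [integral_smul_nnreal_measure, NNReal.smul_def, smul_eq_mul] at h4
    have h3 := mul_le_integral_inner_sq hl hv
    refine le_of_mul_le_mul_left ?_ (show (0 : ℝ) < 2 * k by positivity)
    calc 2 * k * (‖x‖ * (4 * π * l)) = ‖x‖ * (k * (8 * π * l)) := by ring
      _ ≤ ‖x‖ * (2 * p) := mul_le_mul_of_nonneg_left
        ((mul_le_mul_of_nonneg_left h3 hkpos.le).trans h2) (norm_nonneg _)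
      _ = 2 * (‖x‖ * p) := by ring
      _ ≤ 2 * ((m + 1) * (r ^ (m + 1) * κ)) := by gcongr
      _ = 2 * (((m + 1) * r ^ m * κ) * r) := by ring
      _ ≤ 2 * ((k * S) * r) := by gcongr
      _ = _ := by ring
  exact hfin.trans (mul_le_mul_of_nonneg_left hrS hS0)

/-- if `K` is a convex body with nonempty interior, centre of
mass at the origin, `λ` is the smallest eigenvalue of the coefficient matrix of
`Φ_{n-1}²(K)`, `S(K)` the surface area, and
`R = S(K)/(4πλ) · (S(K)/ω_n)^{1/(n-1)}`, then `K ⊆ R Bⁿ`. -/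
theorem stmt14 {n : ℕ} (hn : 2 ≤ n) (K : Set (En n))
    (hconv : Convex ℝ K) (hcomp : IsCompact K) (hint : (interior K).Nonempty)
    (hcent : (∫ x in K, x ∂(volume : Measure (En n))) = 0)
    (μ : Measure (Sph n)) (hμ : IsSurfaceAreaMeasure K μ)
    (lam : ℝ) (hlampos : 0 < lam)
    (hlam : IsEigenvalue (rank2TensorMatrix μ) lam)
    (hlammin : ∀ l : ℝ, IsEigenvalue (rank2TensorMatrix μ) l → lam ≤ l)
    (R : ℝ)
    (hR : R = (μ Set.univ).toReal / (4 * π * lam)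
        * (((μ Set.univ).toReal / omegaN n) ^ (1 / ((n : ℝ) - 1)))) :
    K ⊆ Metric.closedBall 0 R := by
  obtain ⟨m, rfl⟩ : ∃ m, n = m + 1 := ⟨n - 1, by omega⟩
  have hm : ((m + 1 : ℕ) : ℝ) - 1 = m := by push_cast; ring
  have hμ' : ∀ ω, MeasurableSet ω → μ ω = μH[m] (reverseGauss K ω) := by
    rcases hμ with ⟨-, h⟩ | ⟨h, -⟩
    · intro ω hω
      rw [h ω hω, hm]
      rfl
    · exact absurd h hint.ne_empty
  have := isFiniteMeasure_of_eigenvalue_pos hlampos hlammin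
  intro x hx
  have h := norm_mul_eigenvalue_le (by omega) hconv hcomp hint
    (zero_mem_of_centroid hconv hcomp hint hcent) hμ' hlammin hx
  rw [mem_closedBall_zero_iff, hR, hm, div_mul_eq_mul_div, le_div_iff₀ (by positivity)]
  exact h
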